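/- arXiv:1807.01794 — 2 statements merged into one kernel-verified Lean document; each statement's English description precedes it below -/
import Mathlib

section
/- The sequence p_n = P(G(n,1/2) has property P) does not converge as n → ∞. (This is the semantic content of Theorem 1: the property P is expressible by an existential monadic second order sentence with two monadic variables and first-order quantifier depth 2, and its probability on the uniform random graph has no limit.) -/
open Filter Real

/-- A "configuration" in a graph `G`: two disjoint nonempty cliques `X₁, X₂` with no
edges between them, together with a vertex `x` outside both that is adjacent to every
vertex of `X₁ ∪ X₂`, such that every vertex outside `X₁ ∪ X₂` has a neighbor in `X₁`
and a neighbor in `X₂`. -/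
def IsConfig {n : ℕ} (G : SimpleGraph (Fin n)) (X₁ X₂ : Finset (Fin n)) (x : Fin n) : Prop :=
  X₁.Nonempty ∧ X₂.Nonempty ∧ Disjoint X₁ X₂ ∧
  x ∉ X₁ ∧ x ∉ X₂ ∧
  (∀ u ∈ X₁, ∀ v ∈ X₁, u ≠ v → G.Adj u v) ∧
  (∀ u ∈ X₂, ∀ v ∈ X₂, u ≠ v → G.Adj u v) ∧
  (∀ u ∈ X₁, ∀ v ∈ X₂, ¬ G.Adj u v) ∧
  (∀ u ∈ X₁, G.Adj x u) ∧ (∀ u ∈ X₂, G.Adj x u) ∧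
  (∀ y : Fin n, y ∉ X₁ → y ∉ X₂ →
    (∃ u ∈ X₁, G.Adj y u) ∧ (∃ u ∈ X₂, G.Adj y u))

/-- Property `P` of a graph: existence of a configuration. -/
def PropertyP {n : ℕ} (G : SimpleGraph (Fin n)) : Prop :=
  ∃ (X₁ X₂ : Finset (Fin n)) (x : Fin n), IsConfig G X₁ X₂ x

/-- The probability, under the uniform distribution on graphs on `{1, …, n}`,
of the set of graphs satisfying `Q`. -/
noncomputable def unifProb (n : ℕ) (Q : SimpleGraph (Fin n) → Prop) : ℝ :=
  (Nat.card {G : SimpleGraph (Fin n) // Q G} : ℝ) / 2 ^ (n.choose 2)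

namespace Bowtie

open Finset

/-! ### Uniform random Boolean functions -/

section Prob

variable {ι : Type*} [Fintype ι] [DecidableEq ι]

open Classical in
/-- Expectation of `X` under the uniform distribution on `ι → Bool`. -/
noncomputable def ex (X : (ι → Bool) → ℝ) : ℝ := (∑ f, X f) / 2 ^ Fintype.card ι

open Classical in
/-- Indicator of a proposition. -/
noncomputable def ind (p : Prop) : ℝ := if p then 1 else 0

/-- Probability of `p` under the uniform distribution on `ι → Bool`. -/
noncomputable def pr (p : (ι → Bool) → Prop) : ℝ := ex fun f => ind (p f)

lemma ind_nonneg (p : Prop) : 0 ≤ ind p := by unfold ind; split_ifs <;> norm_num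

lemma ind_and (p q : Prop) : ind (p ∧ q) = ind p * ind q := by
  unfold ind; by_cases p <;> by_cases q <;> simp [*]

lemma ex_mono {X Y : (ι → Bool) → ℝ} (h : ∀ f, X f ≤ Y f) : ex X ≤ ex Y := by
  unfold ex; gcongr; exact h _

lemma ex_add (X Y : (ι → Bool) → ℝ) : ex (fun f => X f + Y f) = ex X + ex Y := by
  simp only [ex, sum_add_distrib, add_div]

lemma ex_sub (X Y : (ι → Bool) → ℝ) : ex (fun f => X f - Y f) = ex X - ex Y := by
  simp only [ex, sum_sub_distrib, sub_div]

lemma ex_sum {α : Type*} (s : Finset α) (X : α → (ι → Bool) → ℝ) :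
    ex (fun f => ∑ a ∈ s, X a f) = ∑ a ∈ s, ex (X a) := by
  simp only [ex]; rw [sum_comm, sum_div]

lemma ex_one : ex (fun _ : ι → Bool => (1 : ℝ)) = 1 := by
  simp [ex]

lemma pr_nonneg (p : (ι → Bool) → Prop) : 0 ≤ pr p := by
  unfold pr ex; exact div_nonneg (sum_nonneg fun _ _ => ind_nonneg _) (by positivity)

lemma pr_mono {p q : (ι → Bool) → Prop} (h : ∀ f, p f → q f) : pr p ≤ pr q := by
  refine ex_mono fun f => ?_
  unfold ind
  by_cases hp : p f
  · simp [hp, h f hp]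
  · simp only [hp, if_false]; split_ifs <;> norm_num

lemma pr_congr {p q : (ι → Bool) → Prop} (h : ∀ f, p f ↔ q f) : pr p = pr q :=
  le_antisymm (pr_mono fun f => (h f).1) (pr_mono fun f => (h f).2)

lemma pr_eq_zero {p : (ι → Bool) → Prop} (h : ∀ f, ¬ p f) : pr p = 0 := by
  simp [pr, ex, ind, h]

lemma pr_or_le (p q : (ι → Bool) → Prop) : pr (fun f => p f ∨ q f) ≤ pr p + pr q := by
  unfold pr
  rw [← ex_add]
  refine ex_mono fun f => ?_
  unfold ind
  by_cases hp : p f <;> by_cases hq : q f <;> simp [hp, hq]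

lemma pr_exists_le {α : Type*} (s : Finset α) (p : α → (ι → Bool) → Prop) :
    pr (fun f => ∃ a ∈ s, p a f) ≤ ∑ a ∈ s, pr (p a) := by
  unfold pr
  rw [← ex_sum]
  refine ex_mono fun f => ?_
  by_cases h : ∃ a ∈ s, p a f
  · obtain ⟨a, ha, hpa⟩ := h
    have h1 : ind (∃ a ∈ s, p a f) = 1 := by
      unfold ind; rw [if_pos ⟨a, ha, hpa⟩]
    have h2 : ind (p a f) = 1 := by unfold ind; rw [if_pos hpa]
    rw [h1, ← h2]
    exact single_le_sum (f := fun a => ind (p a f)) (fun _ _ => ind_nonneg _) ha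
  · have h1 : ind (∃ a ∈ s, p a f) = 0 := by unfold ind; rw [if_neg h]
    rw [h1]
    exact sum_nonneg fun _ _ => ind_nonneg _

/-- Second moment inequality for a counting variable. -/
lemma sq_le_pr_mul {α : Type*} (s : Finset α) (p : α → (ι → Bool) → Prop) :
    (∑ a ∈ s, pr (p a)) ^ 2 ≤
      pr (fun f => ∃ a ∈ s, p a f) * ∑ a ∈ s, ∑ b ∈ s, pr (fun f => p a f ∧ p b f) := by
  have h1 : ∑ a ∈ s, ∑ b ∈ s, pr (fun f => p a f ∧ p b f) =
      ex (fun f => (∑ a ∈ s, ind (p a f)) ^ 2) := by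
    simp only [pr, ← ex_sum, ind_and, sq, sum_mul_sum]
  have h2 : ∑ a ∈ s, pr (p a) =
      ex (fun f => ind (∃ a ∈ s, p a f) * ∑ a ∈ s, ind (p a f)) := by
    simp only [pr, ← ex_sum]
    congr 1; ext f
    by_cases h : ∃ a ∈ s, p a f
    · simp [ind, h]
    · have : ∀ a ∈ s, ind (p a f) = 0 := fun a ha => by
        unfold ind; rw [if_neg fun hp => h ⟨a, ha, hp⟩]
      rw [sum_eq_zero this, mul_zero]
  have h3 : pr (fun f => ∃ a ∈ s, p a f) = ex (fun f => ind (∃ a ∈ s, p a f) ^ 2) := by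
    unfold pr; congr 1; ext f; unfold ind; split_ifs <;> norm_num
  rw [h1, h2, h3]
  unfold ex
  rw [div_pow, div_mul_div_comm, ← sq]
  gcongr
  exact sum_mul_sq_le_sq_mul_sq _ _ _

/-- The event `p` depends only on the coordinates in `I`. -/
def Dep (p : (ι → Bool) → Prop) (I : Finset ι) : Prop :=
  ∀ f g : ι → Bool, (∀ i ∈ I, f i = g i) → (p f ↔ p g)

end Prob

section Dep

variable {ι : Type*}

lemma Dep.mono {p : (ι → Bool) → Prop} {I J : Finset ι} (h : Dep p I) (hIJ : I ⊆ J) :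
    Dep p J := fun f g hfg => h f g fun i hi => hfg i (hIJ hi)

lemma Dep.and [DecidableEq ι] {p q : (ι → Bool) → Prop} {I J : Finset ι} (hp : Dep p I)
    (hq : Dep q J) : Dep (fun f => p f ∧ q f) (I ∪ J) := fun f g hfg =>
  and_congr (hp f g fun i hi => hfg i (mem_union_left _ hi))
    (hq f g fun i hi => hfg i (mem_union_right _ hi))

lemma Dep.forall [DecidableEq ι] {α : Type*} [DecidableEq α] {s : Finset α}
    {p : α → (ι → Bool) → Prop} {I : α → Finset ι} (h : ∀ a ∈ s, Dep (p a) (I a)) :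
    Dep (fun f => ∀ a ∈ s, p a f) (s.biUnion I) := fun f g hfg =>
  forall₂_congr fun a ha => h a ha f g fun i hi => hfg i (mem_biUnion.2 ⟨a, ha, hi⟩)

open Classical in
/-- Events depending on disjoint sets of coordinates are independent. -/
lemma pr_and_of_disjoint [Fintype ι] [DecidableEq ι] {p q : (ι → Bool) → Prop} {I J : Finset ι}
    (hp : Dep p I)
    (hq : Dep q J) (hIJ : Disjoint I J) :
    pr (fun f => p f ∧ q f) = pr p * pr q := by
  have key : (∑ f : ι → Bool, ind (p f ∧ q f)) * ∑ _f : ι → Bool, (1 : ℝ) =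
      (∑ f : ι → Bool, ind (p f)) * ∑ f : ι → Bool, ind (q f) := by
    rw [sum_mul_sum, sum_mul_sum, ← sum_product', ← sum_product']
    let mix : (ι → Bool) → (ι → Bool) → (ι → Bool) := fun f g i => if i ∈ I then f i else g i
    refine sum_nbij' (fun x => (mix x.1 x.2, mix x.2 x.1)) (fun x => (mix x.1 x.2, mix x.2 x.1))
      (by simp) (by simp) ?_ ?_ ?_
    · rintro ⟨f, g⟩ -
      ext i <;> by_cases hi : i ∈ I <;> simp [mix, hi]
    · rintro ⟨f, g⟩ -
      ext i <;> by_cases hi : i ∈ I <;> simp [mix, hi]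
    · rintro ⟨f, g⟩ -
      have h1 : p f ↔ p (mix f g) := hp _ _ fun i hi => by simp [mix, hi]
      have h2 : q f ↔ q (mix g f) := hq _ _ fun i hi => by
        simp [mix, Finset.disjoint_right.1 hIJ hi]
      simp only [mul_one, ← ind_and, ← h1, ← h2]
  have hc : ∑ _f : ι → Bool, (1 : ℝ) = 2 ^ Fintype.card ι := by simp
  rw [hc] at key
  have h0 : (2 : ℝ) ^ Fintype.card ι ≠ 0 := by positivity
  unfold pr ex
  rw [div_mul_div_comm, ← key]
  field_simp

lemma pr_and_forall [Fintype ι] [DecidableEq ι] {α : Type*} [DecidableEq α]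
    {p : (ι → Bool) → Prop} {I : Finset ι}
    (hp : Dep p I) (s : Finset α) {q : α → (ι → Bool) → Prop} {J : α → Finset ι}
    (hq : ∀ a ∈ s, Dep (q a) (J a)) (hIJ : ∀ a ∈ s, Disjoint I (J a))
    (hJ : ∀ a ∈ s, ∀ b ∈ s, a ≠ b → Disjoint (J a) (J b)) :
    pr (fun f => p f ∧ ∀ a ∈ s, q a f) = pr p * ∏ a ∈ s, pr (q a) := by
  induction s using Finset.induction_on with
  | empty => simp
  | insert a s ha ih =>
    have ih' := ih (fun b hb => hq b (mem_insert_of_mem hb))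
      (fun b hb => hIJ b (mem_insert_of_mem hb))
      (fun b hb c hc => hJ b (mem_insert_of_mem hb) c (mem_insert_of_mem hc))
    have h1 : pr (fun f => p f ∧ ∀ b ∈ insert a s, q b f) =
        pr (fun f => (p f ∧ ∀ b ∈ s, q b f) ∧ q a f) :=
      pr_congr fun f => by rw [forall_mem_insert]; tauto
    rw [h1, pr_and_of_disjoint (hp.and (Dep.forall fun b hb => hq b (mem_insert_of_mem hb)))
      (hq a (mem_insert_self _ _)), ih', prod_insert ha]
    · ring
    · rw [disjoint_union_left, disjoint_biUnion_left]
      refine ⟨hIJ a (mem_insert_self _ _), fun b hb => hJ b (mem_insert_of_mem hb) a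
        (mem_insert_self _ _) ?_⟩
      rintro rfl; exact ha hb

lemma dep_agree (I : Finset ι) (g : ι → Bool) : Dep (fun f => ∀ i ∈ I, f i = g i) I :=
  fun f f' h => forall₂_congr fun i hi => by rw [h i hi]

open Classical in
lemma pr_agree [Fintype ι] [DecidableEq ι] (I : Finset ι) (g : ι → Bool) :
    pr (fun f => ∀ i ∈ I, f i = g i) = (1 / 2) ^ I.card := by
  have h1 : (univ.filter fun f : ι → Bool => ∀ i ∈ I, f i = g i) =
      Fintype.piFinset fun i => if i ∈ I then {g i} else univ := by
    ext f
    simp only [mem_filter, mem_univ, true_and, Fintype.mem_piFinset]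
    refine forall_congr' fun i => ?_
    by_cases hi : i ∈ I <;> simp [hi]
  have h2 : ∑ f : ι → Bool, ind (∀ i ∈ I, f i = g i) = 2 ^ (Fintype.card ι - I.card) := by
    have h0 : ∑ f : ι → Bool, ind (∀ i ∈ I, f i = g i) =
        #(univ.filter fun f : ι → Bool => ∀ i ∈ I, f i = g i) := by
      rw [card_filter, Nat.cast_sum]
      exact sum_congr rfl fun f _ => by simp [ind]
    rw [h0, h1, Fintype.card_piFinset]
    have : ∀ i, #(if i ∈ I then {g i} else univ : Finset Bool) = if i ∈ Iᶜ then 2 else 1 := by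
      intro i; by_cases hi : i ∈ I <;> simp [hi]
    simp_rw [this]
    rw [prod_ite_mem]
    simp [card_compl]
  have h3 : I.card ≤ Fintype.card ι := card_le_univ I
  unfold pr ex
  rw [h2, div_eq_iff (by positivity), ← Nat.sub_add_cancel h3, pow_add, Nat.sub_add_cancel h3]
  rw [one_div, inv_pow]
  field_simp

end Dep

section Graph

variable {V : Type*} [DecidableEq V]

/-- The unordered pairs of distinct elements of `S`. -/
def pairs (S : Finset V) : Finset (Sym2 V) := S.offDiag.image fun p => s(p.1, p.2)

lemma mk_mem_pairs {S : Finset V} {u v : V} : s(u, v) ∈ pairs S ↔ u ∈ S ∧ v ∈ S ∧ u ≠ v := by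
  simp only [pairs, mem_image, mem_offDiag, Prod.exists, Sym2.eq_iff]
  constructor
  · rintro ⟨a, b, ⟨ha, hb, hab⟩, ⟨rfl, rfl⟩ | ⟨rfl, rfl⟩⟩
    · exact ⟨ha, hb, hab⟩
    · exact ⟨hb, ha, hab.symm⟩
  · rintro ⟨hu, hv, huv⟩
    exact ⟨u, v, ⟨hu, hv, huv⟩, Or.inl ⟨rfl, rfl⟩⟩

lemma card_pairs (S : Finset V) : #(pairs S) = (#S).choose 2 := Sym2.card_image_offDiag S

lemma pairs_inter (S T : Finset V) : pairs S ∩ pairs T = pairs (S ∩ T) := by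
  ext e
  induction e with
  | _ u v => simp only [mem_inter, mk_mem_pairs]; tauto

lemma pairs_mono {S T : Finset V} (h : S ⊆ T) : pairs S ⊆ pairs T := by
  intro e
  induction e with
  | _ u v => simp only [mk_mem_pairs]; exact fun ⟨a, b, c⟩ => ⟨h a, h b, c⟩

lemma card_pairs_union (S T : Finset V) :
    #(pairs S ∪ pairs T) + (#(S ∩ T)).choose 2 = (#S).choose 2 + (#T).choose 2 := by
  rw [← card_pairs, ← card_pairs, ← card_pairs, ← pairs_inter, card_union_add_card_inter]

/-- The potential edges joining `v` to `W`. -/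
def star (v : V) (W : Finset V) : Finset (Sym2 V) := W.image fun u => s(v, u)

lemma star_mono (v : V) {W W' : Finset V} (h : W ⊆ W') : star v W ⊆ star v W' :=
  image_subset_image h

lemma card_star (v : V) (W : Finset V) : #(star v W) = #W :=
  card_image_of_injective _ fun _ _ h => Sym2.congr_right.1 h

lemma disjoint_pairs_star {W : Finset V} {v : V} (hv : v ∉ W) :
    Disjoint (pairs W) (star v W) := by
  rw [Finset.disjoint_left]
  intro e he h
  obtain ⟨u, -, rfl⟩ := mem_image.1 h
  exact hv (mk_mem_pairs.1 he).1

lemma disjoint_star_star {W : Finset V} {v w : V} (hv : v ∉ W) (hvw : v ≠ w) :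
    Disjoint (star v W) (star w W) := by
  rw [Finset.disjoint_left]
  intro e he h
  obtain ⟨a, ha, rfl⟩ := mem_image.1 he
  obtain ⟨b, hb, h⟩ := mem_image.1 h
  rcases Sym2.eq_iff.1 h with ⟨rfl, -⟩ | ⟨-, rfl⟩
  · exact hvw rfl
  · exact hv hb

/-- No edge of `f` joins `v` to `Y`. -/
def Missed (v : V) (Y : Finset V) (f : Sym2 V → Bool) : Prop := ∀ u ∈ Y, f s(v, u) = false

lemma missed_iff (v : V) (Y : Finset V) (f : Sym2 V → Bool) :
    Missed v Y f ↔ ∀ e ∈ star v Y, f e = (fun _ => false) e := by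
  simp [Missed, star]

lemma pr_missed [Fintype V] (v : V) (Y : Finset V) : pr (Missed v Y) = (1 / 2) ^ #Y := by
  rw [pr_congr (missed_iff v Y), pr_agree, card_star]

lemma missed_union (v : V) (Y Z : Finset V) (f : Sym2 V → Bool) :
    Missed v (Y ∪ Z) f ↔ Missed v Y f ∧ Missed v Z f := forall_mem_union

lemma dep_missed (v : V) {Y W : Finset V} (h : Y ⊆ W) : Dep (Missed v Y) (star v W) := by
  intro f g hfg
  rw [missed_iff, missed_iff]
  exact dep_agree _ _ f g fun e he => hfg e (star_mono v h he)

lemma ex_missed_mul [Fintype V] (v : V) (Y Z : Finset V) :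
    ex (fun f => ind (Missed v Y f) * ind (Missed v Z f)) = (1 / 2) ^ #(Y ∪ Z) := by
  rw [← pr_missed v]
  unfold pr
  congr 1; ext f
  rw [missed_union, ind_and]

lemma ind_not (p : Prop) : ind (¬ p) = 1 - ind p := by
  unfold ind; by_cases p <;> simp [*]

lemma pr_not_missed_two [Fintype V] (v : V) {A B : Finset V} (h : Disjoint A B) :
    pr (fun f => ¬ Missed v A f ∧ ¬ Missed v B f) =
      (1 - (1 / 2) ^ #A) * (1 - (1 / 2) ^ #B) := by
  have h1 : pr (fun f => ¬ Missed v A f ∧ ¬ Missed v B f) =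
      ex (fun f => (1 - ind (Missed v A f)) - ind (Missed v B f) +
        ind (Missed v A f) * ind (Missed v B f)) := by
    unfold pr; congr 1; ext f
    rw [ind_and, ind_not, ind_not]; ring
  rw [h1, ex_add, ex_sub, ex_sub, ex_one, ex_missed_mul, card_union_of_disjoint h]
  have hA : ex (fun f => ind (Missed v A f)) = (1 / 2) ^ #A := pr_missed v A
  have hB : ex (fun f => ind (Missed v B f)) = (1 / 2) ^ #B := pr_missed v B
  rw [hA, hB]; ring

lemma pr_not_missed_four_le [Fintype V] (v : V) {A B C D : Finset V} {m : ℕ} {w : ℝ} (hA : #A = m)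
    (hB : #B = m) (hC : #C = m) (hD : #D = m)
    (hAB : (1 / 2 : ℝ) ^ #(A ∪ B) ≤ w) (hAC : (1 / 2 : ℝ) ^ #(A ∪ C) ≤ w)
    (hAD : (1 / 2 : ℝ) ^ #(A ∪ D) ≤ w) (hBC : (1 / 2 : ℝ) ^ #(B ∪ C) ≤ w)
    (hBD : (1 / 2 : ℝ) ^ #(B ∪ D) ≤ w) (hCD : (1 / 2 : ℝ) ^ #(C ∪ D) ≤ w) :
    pr (fun f => (¬ Missed v A f ∧ ¬ Missed v B f) ∧ ¬ Missed v C f ∧ ¬ Missed v D f) ≤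
      1 - 4 * (1 / 2) ^ m + 6 * w := by
  let a f := ind (Missed v A f)
  let b f := ind (Missed v B f)
  let c f := ind (Missed v C f)
  let d f := ind (Missed v D f)
  have h1 : pr (fun f => (¬ Missed v A f ∧ ¬ Missed v B f) ∧ ¬ Missed v C f ∧ ¬ Missed v D f) ≤
      ex (fun f => 1 - a f - b f - c f - d f + a f * b f + a f * c f + a f * d f +
        b f * c f + b f * d f + c f * d f) := by
    refine ex_mono fun f => ?_
    rw [ind_and, ind_and, ind_and, ind_not, ind_not, ind_not, ind_not]
    simp only [a, b, c, d, ind]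
    split_ifs <;> norm_num
  refine h1.trans ?_
  simp only [ex_add, ex_sub, ex_one, a, b, c, d, ex_missed_mul]
  have e (Y : Finset V) (hY : #Y = m) : ex (fun f => ind (Missed v Y f)) = (1 / 2) ^ m :=
    hY ▸ pr_missed v Y
  rw [e A hA, e B hB, e C hC, e D hD]
  linarith

/-- Prescribed edges inside `W` are independent of the stars at vertices outside `W`. -/
lemma pr_agree_and_forall [Fintype V] {W Z : Finset V} (hZ : Disjoint W Z) {E : Finset (Sym2 V)}
    (hE : E ⊆ pairs W) (g : Sym2 V → Bool) {q : V → (Sym2 V → Bool) → Prop}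
    (hq : ∀ v ∈ Z, Dep (q v) (star v W)) :
    pr (fun f => (∀ e ∈ E, f e = g e) ∧ ∀ v ∈ Z, q v f) =
      (1 / 2) ^ #E * ∏ v ∈ Z, pr (q v) := by
  rw [pr_and_forall (dep_agree E g) Z hq, pr_agree]
  · exact fun v hv => (disjoint_pairs_star (Finset.disjoint_right.1 hZ hv)).mono_left hE
  · exact fun v hv w _ hvw => disjoint_star_star (Finset.disjoint_right.1 hZ hv) hvw

/-- The vertex set of the configuration `(A, B, x)`. -/
def supp (A B : Finset V) (x : V) : Finset V := insert x (A ∪ B)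

open Classical in
/-- The adjacency pattern of the configuration `(A, B, x)`: every pair is an edge except for
the pairs between `A` and `B`. -/
noncomputable def pattern (A B : Finset V) (e : Sym2 V) : Bool :=
  decide (¬ ∃ a ∈ A, ∃ b ∈ B, e = s(a, b))

lemma pattern_eq_true {A B : Finset V} {e : Sym2 V} :
    pattern A B e = true ↔ ¬ ∃ a ∈ A, ∃ b ∈ B, e = s(a, b) := by
  rw [pattern, decide_eq_true_iff]

lemma pattern_eq_false {A B : Finset V} {e : Sym2 V} :
    pattern A B e = false ↔ ∃ a ∈ A, ∃ b ∈ B, e = s(a, b) := by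
  rw [pattern, decide_eq_false_iff_not, not_not]

/-- `f` has the pattern of `(A, B, x)` on its support. -/
def Pat (A B : Finset V) (x : V) (f : Sym2 V → Bool) : Prop :=
  ∀ e ∈ pairs (supp A B x), f e = pattern A B e

/-- `f` has the configuration `(A, B, x)`. -/
def Good [Fintype V] (A B : Finset V) (x : V) (f : Sym2 V → Bool) : Prop :=
  Pat A B x f ∧ ∀ v ∈ (supp A B x)ᶜ, ¬ Missed v A f ∧ ¬ Missed v B f

lemma dep_not_missed_two (v : V) {A B W : Finset V} (hA : A ⊆ W) (hB : B ⊆ W) :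
    Dep (fun f => ¬ Missed v A f ∧ ¬ Missed v B f) (star v W) := fun f g h =>
  and_congr (not_congr (dep_missed v hA f g h)) (not_congr (dep_missed v hB f g h))

lemma card_supp {A B : Finset V} {x : V} (h : Disjoint A B) (hA : x ∉ A) (hB : x ∉ B) :
    #(supp A B x) = #A + #B + 1 := by
  rw [supp, card_insert_of_notMem (by simp [hA, hB]), card_union_of_disjoint h]

lemma left_subset_supp (A B : Finset V) (x : V) : A ⊆ supp A B x :=
  subset_union_left.trans (subset_insert _ _)

lemma right_subset_supp (A B : Finset V) (x : V) : B ⊆ supp A B x :=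
  subset_union_right.trans (subset_insert _ _)

lemma pr_good [Fintype V] {A B : Finset V} {x : V} (h : Disjoint A B) (hA : x ∉ A) (hB : x ∉ B) :
    pr (Good A B x) = (1 / 2) ^ (#A + #B + 1).choose 2 *
      ((1 - (1 / 2) ^ #A) * (1 - (1 / 2) ^ #B)) ^ (Fintype.card V - (#A + #B + 1)) := by
  unfold Good Pat
  rw [pr_agree_and_forall (W := supp A B x) disjoint_compl_right subset_rfl (pattern A B)
    (fun v _ => dep_not_missed_two v (left_subset_supp A B x) (right_subset_supp A B x))]
  simp only [pr_not_missed_two _ h]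
  rw [prod_const, card_pairs, card_compl, card_supp h hA hB]

/-- Joint probability of two patterns and of a domination event outside their supports. -/
lemma pr_good_and_good_le [Fintype V] {A B A' B' : Finset V} {x x' : V}
    {q : V → (Sym2 V → Bool) → Prop}
    {D : ℝ} (hq : ∀ v, Dep (q v) (star v (supp A B x ∪ supp A' B' x')))
    (hD : ∀ v, pr (q v) ≤ D)
    (himp : ∀ v f, (¬ Missed v A f ∧ ¬ Missed v B f) → (¬ Missed v A' f ∧ ¬ Missed v B' f) →
      q v f) :
    pr (fun f => Good A B x f ∧ Good A' B' x' f) ≤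
      (1 / 2) ^ #(pairs (supp A B x) ∪ pairs (supp A' B' x')) *
        D ^ (Fintype.card V - #(supp A B x ∪ supp A' B' x')) := by
  classical
  set S := supp A B x with hS
  set S' := supp A' B' x' with hS'
  have h1 := pr_agree_and_forall (W := S ∪ S') (Z := (S ∪ S')ᶜ) disjoint_compl_right
    (union_subset (pairs_mono subset_union_left) (pairs_mono subset_union_right) :
      pairs S ∪ pairs S' ⊆ pairs (S ∪ S'))
    (fun e => if e ∈ pairs S then pattern A B e else pattern A' B' e) (q := q)
    (fun v _ => hq v)
  refine (pr_mono fun f hf => ?_).trans (h1.le.trans ?_)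
  · obtain ⟨⟨h1, h2⟩, h3, h4⟩ := hf
    refine ⟨fun e he => ?_, fun v hv => ?_⟩
    · by_cases h : e ∈ pairs S
      · rw [if_pos h]; exact h1 e h
      · rw [if_neg h]; exact h3 e ((mem_union.1 he).resolve_left h)
    · rw [mem_compl, mem_union, not_or] at hv
      exact himp v f (h2 v (mem_compl.2 hv.1)) (h4 v (mem_compl.2 hv.2))
  · rw [← card_compl]
    exact mul_le_mul_of_nonneg_left ((Finset.prod_le_prod (fun v _ => pr_nonneg _)
      fun v _ => hD v).trans_eq (prod_const D)) (by positivity)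

end Graph

/-- The graph on `Fin n` with edges given by `f`. -/
def graphOf {n : ℕ} (f : Sym2 (Fin n) → Bool) : SimpleGraph (Fin n) where
  Adj u v := u ≠ v ∧ f s(u, v) = true
  symm := ⟨fun u v h => ⟨h.1.symm, by rw [Sym2.eq_swap]; exact h.2⟩⟩
  loopless := ⟨fun u h => h.1 rfl⟩

open Classical in
/-- A Boolean function on unordered pairs is a graph together with its diagonal values. -/
noncomputable def funEquiv (n : ℕ) :
    (Sym2 (Fin n) → Bool) ≃ SimpleGraph (Fin n) × (Fin n → Bool) where
  toFun f := (graphOf f, fun v => f s(v, v))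
  invFun p := Sym2.lift ⟨fun u v => if u = v then p.2 u else decide (p.1.Adj u v), fun u v => by
    by_cases h : u = v
    · subst h; rfl
    · simp only [h, Ne.symm h, if_false, p.1.adj_comm]⟩
  left_inv f := by
    ext e
    induction e with
    | _ u v =>
      by_cases h : u = v
      · subst h; simp
      · simp [h, graphOf]
  right_inv p := by
    obtain ⟨G, d⟩ := p
    ext u v
    · by_cases h : u = v
      · subst h; simp [graphOf]
      · simp [h, graphOf]
    · simp

open Classical in
lemma unifProb_eq_pr (n : ℕ) (Q : SimpleGraph (Fin n) → Prop) :
    unifProb n Q = pr fun f : Sym2 (Fin n) → Bool => Q (graphOf f) := by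
  have h1 : ∑ f : Sym2 (Fin n) → Bool, ind (Q (graphOf f)) =
      2 ^ n * (Nat.card {G : SimpleGraph (Fin n) // Q G} : ℝ) := by
    rw [Fintype.sum_equiv (funEquiv n) (fun f => ind (Q (graphOf f))) (fun p => ind (Q p.1))
      (fun f => rfl),
      Fintype.sum_prod_type]
    simp only [sum_const, card_univ, Fintype.card_fun, Fintype.card_bool, Fintype.card_fin,
      nsmul_eq_mul, Nat.cast_pow, Nat.cast_ofNat]
    rw [← mul_sum]
    congr 1
    rw [Nat.card_eq_fintype_card, Fintype.card_subtype, card_filter, Nat.cast_sum]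
    exact sum_congr rfl fun G _ => by simp [ind]
  have h2 : Fintype.card (Sym2 (Fin n)) = n + n.choose 2 := by
    rw [Sym2.card, Fintype.card_fin, Nat.choose_succ_succ' n 1, Nat.choose_one_right]
  unfold unifProb pr ex
  rw [h1, h2, pow_add]
  field_simp

lemma isConfig_graphOf_iff {n : ℕ} (f : Sym2 (Fin n) → Bool) (A B : Finset (Fin n))
    (x : Fin n) :
    IsConfig (graphOf f) A B x ↔
      (A.Nonempty ∧ B.Nonempty ∧ Disjoint A B ∧ x ∉ A ∧ x ∉ B) ∧ Good A B x f := by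
  classical
  constructor
  · rintro ⟨hA, hB, hAB, hxA, hxB, cA, cB, cAB, xA, xB, dom⟩
    refine ⟨⟨hA, hB, hAB, hxA, hxB⟩, ?_, ?_⟩
    · intro e he
      induction e with
      | _ u v =>
        obtain ⟨hu, hv, huv⟩ := mk_mem_pairs.1 he
        by_cases hcross : ∃ a ∈ A, ∃ b ∈ B, s(u, v) = s(a, b)
        · rw [pattern_eq_false.2 hcross]
          obtain ⟨a, ha, b, hb, hab⟩ := hcross
          rw [hab]
          have := cAB a ha b hb
          have hne : a ≠ b := fun h => Finset.disjoint_left.1 hAB ha (h ▸ hb)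
          simpa [graphOf, hne] using this
        · rw [pattern_eq_true.2 hcross]
          suffices h : (graphOf f).Adj u v from h.2
          simp only [supp, mem_insert, mem_union] at hu hv
          have hc1 : ¬ (u ∈ A ∧ v ∈ B) := fun h => hcross ⟨u, h.1, v, h.2, rfl⟩
          have hc2 : ¬ (v ∈ A ∧ u ∈ B) := fun h => hcross ⟨v, h.1, u, h.2, Sym2.eq_swap⟩
          rcases hu with rfl | hu | hu <;> rcases hv with rfl | hv | hv
          · exact absurd rfl huv
          · exact xA v hv
          · exact xB v hv
          · exact (xA u hu).symm
          · exact cA u hu v hv huv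
          · exact absurd ⟨hu, hv⟩ hc1
          · exact (xB u hu).symm
          · exact absurd ⟨hv, hu⟩ hc2
          · exact cB u hu v hv huv
    · intro v hv
      simp only [supp, mem_compl, mem_insert, mem_union, not_or] at hv
      obtain ⟨⟨a, ha, ha'⟩, b, hb, hb'⟩ := dom v hv.2.1 hv.2.2
      refine ⟨fun h => ?_, fun h => ?_⟩
      · have := ha'.2; rw [h a ha] at this; exact absurd this (by simp)
      · have := hb'.2; rw [h b hb] at this; exact absurd this (by simp)
  · rintro ⟨⟨hA, hB, hAB, hxA, hxB⟩, hp, hd⟩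
    have key (u v : Fin n) (hu : u ∈ supp A B x) (hv : v ∈ supp A B x) (huv : u ≠ v)
        (h1 : ¬ (u ∈ A ∧ v ∈ B)) (h2 : ¬ (v ∈ A ∧ u ∈ B)) : (graphOf f).Adj u v := by
      refine ⟨huv, ?_⟩
      rw [hp _ (mk_mem_pairs.2 ⟨hu, hv, huv⟩), pattern_eq_true]
      rintro ⟨a, ha, b, hb, hab⟩
      rcases Sym2.eq_iff.1 hab with ⟨rfl, rfl⟩ | ⟨rfl, rfl⟩
      · exact h1 ⟨ha, hb⟩
      · exact h2 ⟨ha, hb⟩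
    have mA : ∀ u ∈ A, u ∈ supp A B x := fun u hu => left_subset_supp A B x hu
    have mB : ∀ u ∈ B, u ∈ supp A B x := fun u hu => right_subset_supp A B x hu
    have mx : x ∈ supp A B x := mem_insert_self _ _
    have dAB : ∀ u ∈ A, u ∉ B := fun u hu => Finset.disjoint_left.1 hAB hu
    have xA : ∀ u ∈ A, (graphOf f).Adj x u := fun u hu =>
      key x u mx (mA u hu) (fun h => hxA (h ▸ hu)) (fun h => hxA h.1) (fun h => hxB h.2)
    have xB : ∀ u ∈ B, (graphOf f).Adj x u := fun u hu =>
      key x u mx (mB u hu) (fun h => hxB (h ▸ hu)) (fun h => hxA h.1) (fun h => hxB h.2)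
    refine ⟨hA, hB, hAB, hxA, hxB, ?_, ?_, ?_, xA, xB, ?_⟩
    · exact fun u hu v hv huv => key u v (mA u hu) (mA v hv) huv
        (fun h => dAB v hv h.2) (fun h => dAB u hu h.2)
    · exact fun u hu v hv huv => key u v (mB u hu) (mB v hv) huv
        (fun h => dAB u h.1 hu) (fun h => dAB v h.1 hv)
    · rintro u hu v hv ⟨huv, h⟩
      rw [hp _ (mk_mem_pairs.2 ⟨mA u hu, mB v hv, huv⟩), pattern_eq_true] at h
      exact h ⟨u, hu, v, hv, rfl⟩
    · intro y hyA hyB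
      by_cases hyx : y = x
      · subst hyx
        obtain ⟨a, ha⟩ := hA
        obtain ⟨b, hb⟩ := hB
        exact ⟨⟨a, ha, xA a ha⟩, b, hb, xB b hb⟩
      · obtain ⟨h1, h2⟩ := hd y (by simp [supp, hyA, hyB, hyx])
        simp only [Missed, not_forall, Bool.not_eq_false] at h1 h2
        obtain ⟨a, ha, ha'⟩ := h1
        obtain ⟨b, hb, hb'⟩ := h2
        exact ⟨⟨a, ha, fun h => hyA (h ▸ ha), ha'⟩, b, hb, fun h => hyB (h ▸ hb), hb'⟩

/-- The first moment bound for the number of configurations with parts of sizes `k` and `l`. -/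
noncomputable def firstMoment (n k l : ℕ) : ℝ :=
  n.choose k * (n.choose l * (n * ((1 / 2) ^ (k + l + 1).choose 2 *
    ((1 - (1 / 2) ^ k) * (1 - (1 / 2) ^ l)) ^ (n - (k + l + 1)))))

lemma half_pow_le_one (k : ℕ) : (1 / 2 : ℝ) ^ k ≤ 1 := pow_le_one₀ (by norm_num) (by norm_num)

lemma pr_and_good_le {n : ℕ} (A B : Finset (Fin n)) (x : Fin n) :
    pr (fun f => (Disjoint A B ∧ x ∉ A ∧ x ∉ B) ∧ Good A B x f) ≤
      (1 / 2) ^ (#A + #B + 1).choose 2 *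
        ((1 - (1 / 2) ^ #A) * (1 - (1 / 2) ^ #B)) ^ (n - (#A + #B + 1)) := by
  by_cases h : Disjoint A B ∧ x ∉ A ∧ x ∉ B
  · refine (pr_mono fun f hf => hf.2).trans ?_
    rw [pr_good h.1 h.2.1 h.2.2, Fintype.card_fin]
  · rw [pr_eq_zero fun f hf => h hf.1]
    have h1 := half_pow_le_one #A
    have h2 := half_pow_le_one #B
    have : 0 ≤ (1 - (1 / 2 : ℝ) ^ #A) * (1 - (1 / 2) ^ #B) :=
      mul_nonneg (by linarith) (by linarith)
    positivity

lemma pr_clique_le (n s : ℕ) :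
    pr (fun f : Sym2 (Fin n) → Bool =>
      ∃ S ∈ powersetCard s (univ : Finset (Fin n)), ∀ e ∈ pairs S, f e = true) ≤
      n.choose s * (1 / 2) ^ s.choose 2 := by
  refine (pr_exists_le _ _).trans ?_
  refine (sum_le_card_nsmul _ _ ((1 / 2) ^ s.choose 2) fun S hS => ?_).trans_eq ?_
  · rw [pr_agree (pairs S) fun _ => true, card_pairs, (mem_powersetCard.1 hS).2]
  · rw [card_powersetCard, card_univ, Fintype.card_fin, nsmul_eq_mul]

lemma pr_config_le (n k l : ℕ) :
    pr (fun f : Sym2 (Fin n) → Bool => ∃ A ∈ powersetCard k univ, ∃ B ∈ powersetCard l univ,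
      ∃ x ∈ univ, (Disjoint A B ∧ x ∉ A ∧ x ∉ B) ∧ Good A B x f) ≤ firstMoment n k l := by
  have hc (k : ℕ) : #(powersetCard k (univ : Finset (Fin n))) = n.choose k := by
    rw [card_powersetCard, card_univ, Fintype.card_fin]
  unfold firstMoment
  refine (pr_exists_le _ _).trans ?_
  refine (sum_le_card_nsmul _ _ _ fun A hA => ?_).trans_eq (by rw [hc, nsmul_eq_mul])
  refine (pr_exists_le _ _).trans ?_
  refine (sum_le_card_nsmul _ _ _ fun B hB => ?_).trans_eq (by rw [hc, nsmul_eq_mul])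
  refine (pr_exists_le _ _).trans ?_
  refine (sum_le_card_nsmul _ _ _ fun x _ => ?_).trans_eq
    (by rw [card_univ, Fintype.card_fin, nsmul_eq_mul])
  have := pr_and_good_le A B x
  rwa [(mem_powersetCard.1 hA).2, (mem_powersetCard.1 hB).2] at this

lemma unifProb_le (n s : ℕ) :
    unifProb n PropertyP ≤ n.choose s * (1 / 2) ^ s.choose 2 +
      ∑ k ∈ Ico 1 s, ∑ l ∈ Ico 1 s, firstMoment n k l := by
  classical
  rw [unifProb_eq_pr]
  have key : ∀ f : Sym2 (Fin n) → Bool, PropertyP (graphOf f) →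
      (∃ S ∈ powersetCard s (univ : Finset (Fin n)), ∀ e ∈ pairs S, f e = true) ∨
      ∃ k ∈ Ico 1 s, ∃ l ∈ Ico 1 s, ∃ A ∈ powersetCard k univ, ∃ B ∈ powersetCard l univ,
      ∃ x ∈ univ, (Disjoint A B ∧ x ∉ A ∧ x ∉ B) ∧ Good A B x f := by
    rintro f ⟨A, B, x, hc⟩
    have clique (X : Finset (Fin n))
        (hX : ∀ u ∈ X, ∀ v ∈ X, u ≠ v → (graphOf f).Adj u v) (hs : s ≤ #X) :
        ∃ S ∈ powersetCard s (univ : Finset (Fin n)), ∀ e ∈ pairs S, f e = true := by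
      obtain ⟨S, hSX, hS⟩ := exists_subset_card_eq hs
      refine ⟨S, mem_powersetCard.2 ⟨subset_univ _, hS⟩, fun e he => ?_⟩
      induction e with
      | _ u v =>
        obtain ⟨hu, hv, huv⟩ := mk_mem_pairs.1 he
        exact (hX u (hSX hu) v (hSX hv) huv).2
    by_cases hA : s ≤ #A
    · exact Or.inl (clique A hc.2.2.2.2.2.1 hA)
    by_cases hB : s ≤ #B
    · exact Or.inl (clique B hc.2.2.2.2.2.2.1 hB)
    obtain ⟨⟨nA, nB, hAB, hxA, hxB⟩, hg⟩ := (isConfig_graphOf_iff f A B x).1 hc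
    exact Or.inr ⟨#A, mem_Ico.2 ⟨nA.card_pos, not_le.1 hA⟩, #B,
      mem_Ico.2 ⟨nB.card_pos, not_le.1 hB⟩, A, mem_powersetCard.2 ⟨subset_univ _, rfl⟩, B,
      mem_powersetCard.2 ⟨subset_univ _, rfl⟩, x, mem_univ _, ⟨hAB, hxA, hxB⟩, hg⟩
  refine (pr_mono key).trans ((pr_or_le _ _).trans (add_le_add (pr_clique_le n s) ?_))
  refine (pr_exists_le _ _).trans (sum_le_sum fun k _ => ?_)
  exact (pr_exists_le _ _).trans (sum_le_sum fun l _ => pr_config_le n k l)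

lemma hundred_mul_le_two_pow {j : ℕ} (hj : 10 ≤ j) : 100 * j ≤ 2 ^ j := by
  induction j, hj using Nat.le_induction with
  | base => norm_num
  | succ j hj ih => rw [pow_succ]; omega

lemma half_pow_choose_le (K t : ℕ) :
    (1 / 2 : ℝ) ^ (t + 1).choose 2 ≤ 2 ^ (2 * K ^ 2 + K) * (1 / 2) ^ ((2 * K + 1) * t) := by
  have h1 : (2 * K + 1) * t ≤ (t + 1).choose 2 + (2 * K ^ 2 + K) := by
    have h2 : 2 * (t + 1).choose 2 = (t + 1) * t := by
      rw [Nat.choose_two_right, Nat.add_sub_cancel, mul_comm,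
        Nat.div_mul_cancel (by simpa [mul_comm] using (Nat.even_mul_succ_self t).two_dvd)]
    rcases le_total t (2 * K) with h | h
    · obtain ⟨a, ha⟩ := Nat.exists_eq_add_of_le h
      have hK : (2 * K : ℤ) = t + a := by exact_mod_cast ha
      zify at h2 ⊢
      nlinarith [sq_nonneg (a : ℤ), Int.natCast_nonneg a]
    · obtain ⟨a, rfl⟩ := Nat.exists_eq_add_of_le h
      have : a ≤ a ^ 2 := Nat.le_self_pow two_ne_zero a
      nlinarith
  calc (1 / 2 : ℝ) ^ (t + 1).choose 2
      = 2 ^ (2 * K ^ 2 + K) * (1 / 2) ^ ((t + 1).choose 2 + (2 * K ^ 2 + K)) := by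
        rw [pow_add (1 / 2 : ℝ), mul_left_comm, ← mul_pow]; norm_num
    _ ≤ _ := by
        gcongr 2 ^ _ * ?_
        exact pow_le_pow_of_le_one (by norm_num) (by norm_num) h1

/-- One of the two factors into which the bound on `firstMoment` decouples. -/
noncomputable def factor (n L K k : ℕ) : ℝ :=
  2 ^ (K + K ^ 2) * (n ^ k / k.factorial * (1 / 2) ^ ((2 * K + 1) * k) *
    exp (-((1 / 2) ^ k * (n - 8 * L))))

lemma one_sub_half_pow_le {n L k N : ℕ} (hN : (n : ℝ) - 8 * L ≤ N) :
    (1 - (1 / 2 : ℝ) ^ k) ^ N ≤ exp (-((1 / 2) ^ k * (n - 8 * L))) := by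
  have h1 : (1 - (1 / 2 : ℝ) ^ k) ≤ exp (-(1 / 2) ^ k) := one_sub_le_exp_neg _
  have h2 := half_pow_le_one k
  calc (1 - (1 / 2 : ℝ) ^ k) ^ N ≤ exp (-(1 / 2) ^ k) ^ N :=
        pow_le_pow_left₀ (by linarith) h1 N
    _ = exp (-((1 / 2) ^ k * N)) := by rw [← exp_nat_mul]; ring_nf
    _ ≤ _ := by gcongr

lemma firstMoment_le {n L K k l : ℕ} (hn : 2 * n = 3 * (2 ^ K * L)) (hk : k < 4 * L)
    (hl : l < 4 * L) :
    firstMoment n k l ≤ 3 / 2 * L * (factor n L K k * factor n L K l) := by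
  have hN : (n : ℝ) - 8 * L ≤ (n - (k + l + 1) : ℕ) := by
    rw [sub_le_iff_le_add]
    have : n ≤ (n - (k + l + 1)) + 8 * L := by omega
    exact_mod_cast this
  have hn' : (n : ℝ) = 3 / 2 * (2 ^ K * L) := by
    have : (2 * n : ℝ) = 3 * (2 ^ K * L) := by exact_mod_cast hn
    linarith
  have hk1 := half_pow_le_one k
  have hl1 := half_pow_le_one l
  have hp := one_sub_half_pow_le (k := k) hN
  have hq := one_sub_half_pow_le (k := l) hN
  have hp0 : 0 ≤ (1 - (1 / 2 : ℝ) ^ k) ^ (n - (k + l + 1)) := pow_nonneg (by linarith) _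
  have hq0 : 0 ≤ (1 - (1 / 2 : ℝ) ^ l) ^ (n - (k + l + 1)) := pow_nonneg (by linarith) _
  unfold firstMoment factor
  rw [mul_pow]
  generalize (1 - (1 / 2 : ℝ) ^ k) ^ (n - (k + l + 1)) = p at *
  generalize (1 - (1 / 2 : ℝ) ^ l) ^ (n - (k + l + 1)) = q at *
  calc (n.choose k : ℝ) * (n.choose l * (n * ((1 / 2) ^ (k + l + 1).choose 2 * (p * q))))
      ≤ n ^ k / k.factorial * (n ^ l / l.factorial * (n * (2 ^ (2 * K ^ 2 + K) *
        (1 / 2) ^ ((2 * K + 1) * (k + l)) * (exp (-((1 / 2) ^ k * (n - 8 * L))) *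
        exp (-((1 / 2) ^ l * (n - 8 * L))))))) := by
        gcongr
        · exact Nat.choose_le_pow_div k n
        · exact Nat.choose_le_pow_div l n
        · exact half_pow_choose_le K (k + l)
    _ = _ := by
        generalize exp (-((1 / 2) ^ k * ((n : ℝ) - 8 * L))) = e₁
        generalize exp (-((1 / 2) ^ l * ((n : ℝ) - 8 * L))) = e₂
        generalize ha : (n : ℝ) ^ k / k.factorial = a
        generalize hb : (n : ℝ) ^ l / l.factorial = b
        rw [hn']
        ring

lemma log_bounds : log (3 / 2) ≤ 0.41 ∧ 0 ≤ log (3 / 2) ∧ 0.693 ≤ log 2 ∧ log 2 ≤ 0.6932 := by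
  refine ⟨?_, log_nonneg (by norm_num), by linarith [log_two_gt_d9], by linarith [log_two_lt_d9]⟩
  rw [log_le_iff_le_exp (by norm_num)]
  have h := Real.sum_le_exp_of_nonneg (x := 0.41) (by norm_num) 4
  refine le_trans ?_ h
  norm_num [Finset.sum_range_succ, Nat.factorial]

lemma factor_le_exp {n L K k : ℕ} (hL : 0 < L) (hn : 2 * n = 3 * (2 ^ K * L)) :
    factor n L K k ≤ exp ((K + K ^ 2 - K * k) * log 2 + k * (log (3 / 2) - log 2) + L -
      (1 / 2) ^ k * (n - 8 * L)) := by
  have hL' : (0 : ℝ) < L := by exact_mod_cast hL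
  have hn' : (n : ℝ) = 3 / 2 * (2 ^ K * L) := by
    have : (2 * n : ℝ) = 3 * (2 ^ K * L) := by exact_mod_cast hn
    linarith
  have h1 : (n : ℝ) ^ k / k.factorial * (1 / 2) ^ ((2 * K + 1) * k) ≤
      (3 / 4 * (1 / 2) ^ K) ^ k * exp L := by
    have h2 := pow_div_factorial_le_exp (x := (L : ℝ)) hL'.le k
    calc (n : ℝ) ^ k / k.factorial * (1 / 2) ^ ((2 * K + 1) * k)
        = (3 / 4 * (1 / 2) ^ K) ^ k * (L ^ k / k.factorial) := by
          have h3 : (n : ℝ) * (1 / 2) ^ (2 * K + 1) = 3 / 4 * (1 / 2) ^ K * L := by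
            have h5 : (2 : ℝ) ^ K * (1 / 2) ^ K = 1 := by rw [← mul_pow]; norm_num
            have h6 : (1 / 2 : ℝ) ^ (2 * K + 1) = (1 / 2) ^ K * (1 / 2) ^ K * (1 / 2) := by ring
            rw [hn', h6]
            linear_combination 3 / 4 * (1 / 2 : ℝ) ^ K * L * h5
          have h4 : (n : ℝ) ^ k * (1 / 2) ^ ((2 * K + 1) * k) =
              (3 / 4 * (1 / 2) ^ K) ^ k * L ^ k := by
            rw [pow_mul, ← mul_pow, h3, mul_pow]
          rw [div_mul_eq_mul_div, h4]; ring
      _ ≤ _ := by gcongr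
  have h3 : (2 : ℝ) ^ (K + K ^ 2) = exp ((K + K ^ 2) * log 2) := by
    rw [← Nat.cast_pow, ← Nat.cast_add, exp_nat_mul, exp_log (by norm_num)]
  have h4 : (3 / 4 * (1 / 2 : ℝ) ^ K) ^ k = exp (k * (log (3 / 2) - log 2 - K * log 2)) := by
    rw [exp_nat_mul, exp_sub, exp_sub, exp_nat_mul, exp_log (by norm_num), exp_log (by norm_num)]
    congr 1
    rw [one_div, inv_pow]; ring
  unfold factor
  calc _ ≤ 2 ^ (K + K ^ 2) * ((3 / 4 * (1 / 2) ^ K) ^ k * exp L *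
        exp (-((1 / 2) ^ k * (n - 8 * L)))) := by gcongr
    _ = _ := by
      rw [h3, h4, ← exp_add, ← exp_add, ← exp_add]
      congr 1; ring

lemma exponent_le {j k n : ℕ} (hj : 10 ≤ j) (hn : 2 * n = 3 * (2 ^ (2 ^ j - j) * 2 ^ j)) :
    (((2 ^ j - j : ℕ) : ℝ) + ((2 ^ j - j : ℕ) : ℝ) ^ 2 - ((2 ^ j - j : ℕ) : ℝ) * k) * log 2 +
      k * (log (3 / 2) - log 2) + (2 ^ j : ℕ) - (1 / 2) ^ k * (n - 8 * (2 ^ j : ℕ)) ≤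
      -((2 ^ j : ℕ) / 100) := by
  have hLj := hundred_mul_le_two_pow hj
  have hK1 : 13 ≤ 2 ^ j - j := by omega
  have hKL : (2 ^ j - j) + j = 2 ^ j := by omega
  have hn' : (n : ℝ) = 3 / 2 * (2 ^ (2 ^ j - j) * (2 ^ j : ℕ)) := by
    have : (2 * n : ℝ) = 3 * (2 ^ (2 ^ j - j) * (2 ^ j : ℕ)) := by exact_mod_cast hn
    linarith
  clear hn
  generalize 2 ^ j = L at *
  generalize L - j = K at *
  have hKL' : (K : ℝ) = L - j := by
    rw [← hKL]; push_cast; ring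
  have hLj' : (100 * j : ℝ) ≤ L := by exact_mod_cast hLj
  have hj' : (10 : ℝ) ≤ j := by exact_mod_cast hj
  obtain ⟨a1, a0, b0, b1⟩ := log_bounds
  generalize log (3 / 2) = a at *
  generalize log 2 = b at *
  have hK8 : 8 * (1 / 2 : ℝ) ^ K ≤ 0.001 := by
    calc 8 * (1 / 2 : ℝ) ^ K ≤ 8 * (1 / 2) ^ 13 := by
          gcongr 8 * ?_
          exact pow_le_pow_of_le_one (by norm_num) (by norm_num) hK1
      _ ≤ 0.001 := by norm_num
  have hK2 : (2 : ℝ) ^ K * (1 / 2) ^ K = 1 := by rw [← mul_pow]; norm_num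
  rw [hn']
  rcases le_or_gt k K with hk | hk
  · obtain ⟨d, rfl⟩ := Nat.exists_eq_add_of_le hk
    have hd : (d : ℝ) + 1 ≤ 2 ^ d := by exact_mod_cast Nat.lt_two_pow_self (n := d)
    have hkd : (1 / 2 : ℝ) ^ k = 2 ^ d * (1 / 2) ^ (k + d) := by
      rw [pow_add (1 / 2 : ℝ), mul_left_comm, ← mul_pow]; norm_num
    have e1 : (1 / 2 : ℝ) ^ k * (3 / 2 * (2 ^ (k + d) * L) - 8 * L) =
        2 ^ d * L * (3 / 2) - 2 ^ d * L * (8 * (1 / 2) ^ (k + d)) := by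
      rw [hkd]; linear_combination 3 / 2 * 2 ^ d * L * hK2
    rw [e1]
    have hx : (0 : ℝ) ≤ 2 ^ d * L := by positivity
    have e2 : (2 : ℝ) ^ d * L * (8 * (1 / 2) ^ (k + d)) ≤ 2 ^ d * L * 0.001 := by gcongr
    have hd0 : (0 : ℝ) ≤ d := Nat.cast_nonneg d
    have hdL : (d : ℝ) * L + L ≤ 2 ^ d * L := by nlinarith
    push_cast at hKL' ⊢
    generalize (2 : ℝ) ^ d * L = X at *
    have hk0 : (0 : ℝ) ≤ k := Nat.cast_nonneg k
    have hkd' : (k : ℝ) + d ≤ L := by linarith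
    have t1 : ((k : ℝ) + d) * d * b ≤ L * d * 0.6932 := by gcongr
    have t2 : (k : ℝ) * a ≤ L * 0.41 := by
      have : (k : ℝ) ≤ L := by linarith
      gcongr
    have t3 : (d : ℝ) * b ≤ 0.001 * (L * d) := by nlinarith
    nlinarith
  · obtain ⟨i, rfl⟩ := Nat.exists_eq_add_of_le hk.le
    have hi : 1 ≤ i := by omega
    have hi' : (1 : ℝ) ≤ i := by exact_mod_cast hi
    have hki : (1 / 2 : ℝ) ^ (K + i) = (1 / 2) ^ K * (1 / 2) ^ i := pow_add _ _ _
    have e1 : (1 / 2 : ℝ) ^ (K + i) * (3 / 2 * (2 ^ K * L) - 8 * L) =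
        L * ((1 / 2) ^ i * (3 / 2)) - L * ((8 * (1 / 2) ^ K) * (1 / 2) ^ i) := by
      rw [hki]; linear_combination 3 / 2 * (1 / 2) ^ i * L * hK2
    rw [e1]
    have e2 : (L : ℝ) * ((8 * (1 / 2) ^ K) * (1 / 2) ^ i) ≤ L * (0.001 * 1) := by
      gcongr; exact half_pow_le_one i
    have e3 : -(0.686 : ℝ) * i + 1.411 - (1 / 2) ^ i * (3 / 2) ≤ -0.01 := by
      rcases eq_or_lt_of_le hi with rfl | hi2
      · norm_num
      rcases eq_or_lt_of_le (Nat.succ_le_of_lt hi2) with rfl | hi3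
      · norm_num
      · have : (3 : ℝ) ≤ i := by exact_mod_cast hi3
        have : (0 : ℝ) ≤ (1 / 2) ^ i := by positivity
        linarith
    have e4 := mul_le_mul_of_nonneg_left e3 (Nat.cast_nonneg L : (0 : ℝ) ≤ L)
    push_cast
    rw [hKL']
    have hjL : (j : ℝ) ≤ L := by linarith
    have t1 : (i : ℝ) * (L - j) * 0.693 ≤ i * (L - j) * b := by gcongr
    have t2 : (L - j : ℝ) * a ≤ L * 0.41 := by nlinarith
    have t3 : (i : ℝ) * (a - b) ≤ 0 := by nlinarith
    have t4 : (i : ℝ) * (100 * j) ≤ i * L := by gcongr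
    nlinarith

lemma choose_mul_half_pow_le {n L : ℕ} (hL : 2 ≤ L) (hn : n ≤ 2 ^ (L + 1)) :
    (n.choose (4 * L) : ℝ) * (1 / 2) ^ (4 * L).choose 2 ≤ (1 / 2) ^ L := by
  have h1 : (n.choose (4 * L) : ℝ) ≤ 2 ^ ((L + 1) * (4 * L)) := by
    rw [pow_mul]
    exact_mod_cast (Nat.choose_le_pow n (4 * L)).trans (Nat.pow_le_pow_left hn _)
  have h2 : (4 * L).choose 2 = 2 * L * (4 * L - 1) := by
    rw [Nat.choose_two_right]
    exact Nat.div_eq_of_eq_mul_left two_pos (by ring)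
  have h3 : (L + 1) * (4 * L) + L ≤ (4 * L).choose 2 := by
    rw [h2]
    obtain ⟨a, rfl⟩ := Nat.exists_eq_add_of_le hL
    have : 4 * (2 + a) - 1 = 7 + 4 * a := by omega
    rw [this]; nlinarith
  calc (n.choose (4 * L) : ℝ) * (1 / 2) ^ (4 * L).choose 2
      ≤ 2 ^ ((L + 1) * (4 * L)) * (1 / 2) ^ ((L + 1) * (4 * L) + L) := by
        gcongr ?_ * ?_
        exact pow_le_pow_of_le_one (by norm_num) (by norm_num) h3
    _ = (1 / 2) ^ L := by
        rw [pow_add, ← mul_assoc, ← mul_pow]; norm_num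

lemma unifProb_three_mul_le {j : ℕ} (hj : 10 ≤ j) :
    unifProb (3 * 2 ^ (2 ^ j - 1)) PropertyP ≤
      (1 / 2) ^ 2 ^ j + 24 * (((2 ^ j : ℕ) : ℝ) ^ 3 * exp (-(1 / 50 * (2 ^ j : ℕ)))) := by
  have hLj := hundred_mul_le_two_pow hj
  set n := 3 * 2 ^ (2 ^ j - 1) with hn
  have hn1 : 2 * n = 3 * 2 ^ 2 ^ j := by
    rw [hn, mul_left_comm, ← pow_succ', Nat.sub_add_cancel (by omega)]
  have hn2 : 2 * n = 3 * (2 ^ (2 ^ j - j) * 2 ^ j) := by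
    rw [hn1, ← pow_add, Nat.sub_add_cancel (by omega)]
  refine (unifProb_le n (4 * 2 ^ j)).trans (add_le_add
    (choose_mul_half_pow_le (by omega) (by rw [pow_succ]; omega)) ?_)
  set L := 2 ^ j with hL
  have hf (k : ℕ) : factor n L (L - j) k ≤ exp (-(L / 100)) :=
    (factor_le_exp (by omega) hn2).trans (exp_le_exp.2 (exponent_le hj hn2))
  have hf0 (k : ℕ) : 0 ≤ factor n L (L - j) k := by unfold factor; positivity
  have hb : ∀ k ∈ Ico 1 (4 * L), ∀ l ∈ Ico 1 (4 * L),
      firstMoment n k l ≤ 3 / 2 * L * exp (-(1 / 50 * L)) := fun k hk l hl => by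
    refine (firstMoment_le hn2 (mem_Ico.1 hk).2 (mem_Ico.1 hl).2).trans ?_
    have : exp (-(1 / 50 * L)) = exp (-((L : ℝ) / 100)) * exp (-((L : ℝ) / 100)) := by
      rw [← exp_add]; ring_nf
    rw [this]
    gcongr
    exacts [hf0 l, hf k, hf l]
  have hc : ((#(Ico 1 (4 * L)) : ℕ) : ℝ) ≤ 4 * L := by
    rw [Nat.card_Ico]; exact_mod_cast Nat.sub_le _ _
  calc ∑ k ∈ Ico 1 (4 * L), ∑ l ∈ Ico 1 (4 * L), firstMoment n k l
      ≤ ∑ k ∈ Ico 1 (4 * L), ∑ l ∈ Ico 1 (4 * L), 3 / 2 * L * exp (-(1 / 50 * L)) :=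
        sum_le_sum fun k hk => sum_le_sum fun l hl => hb k hk l hl
    _ = #(Ico 1 (4 * L)) * (#(Ico 1 (4 * L)) * (3 / 2 * L * exp (-(1 / 50 * L)))) := by
        simp only [sum_const, nsmul_eq_mul]
    _ ≤ 4 * L * (4 * L * (3 / 2 * L * exp (-(1 / 50 * L)))) := by gcongr
    _ = _ := by ring

lemma unifProb_nonneg (n : ℕ) (Q : SimpleGraph (Fin n) → Prop) : 0 ≤ unifProb n Q := by
  unfold unifProb; positivity

lemma tendsto_two_pow : Tendsto (fun j : ℕ => 2 ^ j) atTop (atTop : Filter ℕ) :=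
  tendsto_pow_atTop_atTop_of_one_lt one_lt_two

lemma tendsto_unifProb_three_mul :
    Tendsto (fun j : ℕ => unifProb (3 * 2 ^ (2 ^ j - 1)) PropertyP) atTop (nhds 0) := by
  have h1 : Tendsto (fun L : ℕ => (1 / 2 : ℝ) ^ L) atTop (nhds 0) :=
    tendsto_pow_atTop_nhds_zero_of_lt_one (by norm_num) (by norm_num)
  have h2 : Tendsto (fun L : ℕ => (L : ℝ) ^ 3 * exp (-(1 / 50 * L))) atTop (nhds 0) := by
    have h := (Real.tendsto_pow_mul_exp_neg_atTop_nhds_zero 3).comp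
      (tendsto_natCast_atTop_atTop.const_mul_atTop (by norm_num : (0 : ℝ) < 1 / 50))
    have h' := h.const_mul (50 ^ 3)
    rw [mul_zero] at h'
    refine h'.congr fun L => ?_
    simp only [Function.comp]; ring
  have h3 := (h1.add (h2.const_mul 24)).comp tendsto_two_pow
  rw [mul_zero, add_zero] at h3
  exact tendsto_of_tendsto_of_tendsto_of_le_of_le' tendsto_const_nhds h3
    (Eventually.of_forall fun j => unifProb_nonneg _ _)
    (eventually_atTop.2 ⟨10, fun j hj => unifProb_three_mul_le hj⟩)

section SecondMoment

variable {V : Type*} [DecidableEq V]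

/-- Configurations with both parts of size `m`, encoded by their support, the common neighbor
and the first part. -/
def configs (V : Type*) [Fintype V] [DecidableEq V] (m : ℕ) :
    Finset (Σ _ : Finset V, Σ _ : V, Finset V) :=
  (powersetCard (2 * m + 1) univ).sigma fun S => S.sigma fun x => powersetCard m (S.erase x)

/-- The event that the encoded configuration is present. -/
def Present [Fintype V] (S : Finset V) (x : V) (A : Finset V) (f : Sym2 V → Bool) : Prop :=
  Good A (S.erase x \ A) x f

lemma card_fiber {m : ℕ} {S : Finset V} (hS : #S = 2 * m + 1) :
    #(S.sigma fun x => powersetCard m (S.erase x)) = (2 * m + 1) * (2 * m).choose m := by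
  rw [card_sigma, sum_const_nat (m := (2 * m).choose m), hS]
  intro x hx
  rw [card_powersetCard, card_erase_of_mem hx, hS, Nat.add_sub_cancel]

lemma card_configs [Fintype V] (m : ℕ) : #(configs V m) =
    (Fintype.card V).choose (2 * m + 1) * ((2 * m + 1) * (2 * m).choose m) := by
  rw [configs, card_sigma, sum_const_nat (m := (2 * m + 1) * (2 * m).choose m),
    card_powersetCard, card_univ]
  exact fun S hS => card_fiber (mem_powersetCard.1 hS).2

/-- The basic facts about an encoded configuration. -/
lemma config_facts {m : ℕ} {S A : Finset V} {x : V} (hS : #S = 2 * m + 1) (hx : x ∈ S)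
    (hA : A ∈ powersetCard m (S.erase x)) :
    #A = m ∧ #(S.erase x \ A) = m ∧ Disjoint A (S.erase x \ A) ∧ x ∉ A ∧ x ∉ S.erase x \ A ∧
      supp A (S.erase x \ A) x = S := by
  obtain ⟨hAS, hAm⟩ := mem_powersetCard.1 hA
  refine ⟨hAm, ?_, disjoint_sdiff, fun h => notMem_erase x S (hAS h),
    fun h => notMem_erase x S (mem_sdiff.1 h).1, ?_⟩
  · rw [card_sdiff_of_subset hAS, card_erase_of_mem hx, hS, hAm]; omega
  · rw [supp, union_sdiff_of_subset hAS, insert_erase hx]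

lemma pr_present [Fintype V] {m : ℕ} {S A : Finset V} {x : V} (hS : #S = 2 * m + 1) (hx : x ∈ S)
    (hA : A ∈ powersetCard m (S.erase x)) :
    pr (Present S x A) = (1 / 2) ^ (2 * m + 1).choose 2 *
      ((1 - (1 / 2) ^ m) * (1 - (1 / 2) ^ m)) ^ (Fintype.card V - (2 * m + 1)) := by
  obtain ⟨h1, h2, h3, h4, h5, -⟩ := config_facts hS hx hA
  unfold Present
  rw [pr_good h3 h4 h5, h1, h2, two_mul]

/-- On its support a present configuration determines which pairs are edges. -/
lemma Present.adj_iff [Fintype V] {m : ℕ} {S A : Finset V} {x : V} (hS : #S = 2 * m + 1)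
    (hx : x ∈ S)
    (hA : A ∈ powersetCard m (S.erase x)) {f : Sym2 V → Bool} (hf : Present S x A f)
    {u v : V} (hu : u ∈ S.erase x) (hv : v ∈ S.erase x) (huv : u ≠ v) :
    f s(u, v) = true ↔ (u ∈ A ↔ v ∈ A) := by
  obtain ⟨-, -, -, -, -, h⟩ := config_facts hS hx hA
  have h1 := hf.1 s(u, v) (by
    rw [h]; exact mk_mem_pairs.2 ⟨mem_of_mem_erase hu, mem_of_mem_erase hv, huv⟩)
  rw [h1, pattern_eq_true]
  constructor
  · intro hn
    by_contra hc
    rcases Classical.em (u ∈ A) with hA | hA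
    · exact hn ⟨u, hA, v, mem_sdiff.2 ⟨hv, fun h => hc (by tauto)⟩, rfl⟩
    · exact hn ⟨v, by tauto, u, mem_sdiff.2 ⟨hu, hA⟩, Sym2.eq_swap⟩
  · rintro hiff ⟨a, ha, b, hb, hab⟩
    have hb := Finset.mem_sdiff.1 hb
    rcases Sym2.eq_iff.1 hab with ⟨rfl, rfl⟩ | ⟨rfl, rfl⟩ <;> tauto

lemma Present.adj_center [Fintype V] {m : ℕ} {S A : Finset V} {x : V} (hS : #S = 2 * m + 1)
    (hx : x ∈ S)
    (hA : A ∈ powersetCard m (S.erase x)) {f : Sym2 V → Bool} (hf : Present S x A f)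
    {v : V} (hv : v ∈ S.erase x) : f s(x, v) = true := by
  obtain ⟨-, -, -, h4, h5, h⟩ := config_facts hS hx hA
  have h1 := hf.1 s(x, v) (by
    rw [h]; exact mk_mem_pairs.2 ⟨hx, mem_of_mem_erase hv, (ne_of_mem_erase hv).symm⟩)
  rw [h1, pattern_eq_true]
  rintro ⟨a, ha, b, hb, hab⟩
  rcases Sym2.eq_iff.1 hab with ⟨rfl, rfl⟩ | ⟨rfl, rfl⟩
  · exact h4 ha
  · exact h5 hb

/-- Two configurations with the same support that can be simultaneously present have the same
center. -/
lemma center_eq [Fintype V] {m : ℕ} (hm : 1 ≤ m) {S A A' : Finset V} {x x' : V}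
    (hS : #S = 2 * m + 1)
    (hx : x ∈ S) (hA : A ∈ powersetCard m (S.erase x)) (hx' : x' ∈ S)
    (hA' : A' ∈ powersetCard m (S.erase x')) {f : Sym2 V → Bool} (hf : Present S x A f)
    (hf' : Present S x' A' f) : x' = x := by
  by_contra hne
  have hx'S : x' ∈ S.erase x := mem_erase.2 ⟨hne, hx'⟩
  obtain ⟨h1, h2, h3, -, -, -⟩ := config_facts hS hx hA
  have key : ∀ v ∈ S.erase x, v ≠ x' → (x' ∈ A ↔ v ∈ A) := fun v hv hvx =>
    (hf.adj_iff hS hx hA hx'S hv hvx.symm).1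
      (hf'.adj_center hS hx' hA' (mem_erase.2 ⟨hvx, mem_of_mem_erase hv⟩))
  by_cases hxA : x' ∈ A
  · obtain ⟨b, hb⟩ := card_pos.1 (h2 ▸ hm : 0 < #(S.erase x \ A))
    have hb := Finset.mem_sdiff.1 hb
    exact hb.2 ((key b hb.1 fun h => hb.2 (h ▸ hxA)).1 hxA)
  · obtain ⟨a, ha⟩ := card_pos.1 (h1 ▸ hm : 0 < #A)
    exact hxA ((key a ((mem_powersetCard.1 hA).1 ha) fun h => hxA (h ▸ ha)).2 ha)

open Classical in
/-- Given the support and center of a second configuration, there are few choices for its parts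
compatible with a given one. -/
lemma card_compatible_le [Fintype V] {m : ℕ} {S A S' : Finset V} {x x' : V} (hS : #S = 2 * m + 1)
    (hx : x ∈ S) (hA : A ∈ powersetCard m (S.erase x)) (hS' : #S' = 2 * m + 1) (hx' : x' ∈ S') :
    #{A' ∈ powersetCard m (S'.erase x') | ∃ f, Present S x A f ∧ Present S' x' A' f} ≤
      2 * 2 ^ #(S' \ S) := by
  obtain ⟨-, -, -, -, -, hsupp⟩ := config_facts hS hx hA
  set R := (S ∩ S').erase x' with hR
  have hRS' : ∀ u ∈ R, u ∈ S'.erase x' := fun u hu =>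
    mem_erase.2 ⟨ne_of_mem_erase hu, (mem_inter.1 (mem_of_mem_erase hu)).2⟩
  have hRS : ∀ u ∈ R, u ∈ S := fun u hu => (mem_inter.1 (mem_of_mem_erase hu)).1
  obtain ⟨b, hb⟩ : ∃ b : V, R.Nonempty → b ∈ R := by
    by_cases h : R.Nonempty
    · exact ⟨h.choose, fun _ => h.choose_spec⟩
    · exact ⟨x, fun h' => absurd h' h⟩
  have hcard : #((univ : Finset Bool) ×ˢ powerset (S' \ S)) = 2 * 2 ^ #(S' \ S) := by
    rw [card_product, card_powerset, card_univ, Fintype.card_bool]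
  rw [← hcard]
  refine card_le_card_of_injOn (fun A' => (decide (b ∈ A'), A' \ S)) (fun A' hA' => ?_)
    (fun A₁ h₁ A₂ h₂ heq => ?_)
  · obtain ⟨hA', -⟩ := mem_filter.1 (mem_coe.1 hA')
    have hsub := (mem_powersetCard.1 hA').1.trans (erase_subset _ _)
    exact mem_coe.2 (mem_product.2
      ⟨mem_univ _, mem_powerset.2 (sdiff_subset_sdiff hsub subset_rfl)⟩)
  obtain ⟨hA₁, f₁, hf₁, hf₁'⟩ := mem_filter.1 (mem_coe.1 h₁)
  obtain ⟨hA₂, f₂, hf₂, hf₂'⟩ := mem_filter.1 (mem_coe.1 h₂)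
  obtain ⟨hbb, hd⟩ := Prod.mk.inj heq
  have hmem : ∀ u ∈ R, (u ∈ A₁ ↔ u ∈ A₂) := by
    intro u hu
    have hbR := hb ⟨u, hu⟩
    have hb' : (b ∈ A₁) ↔ (b ∈ A₂) := decide_eq_decide.1 hbb
    by_cases huv : u = b
    · rw [huv]; exact hb'
    have e : f₁ s(u, b) = f₂ s(u, b) := by
      have hp : s(u, b) ∈ pairs (supp A (S.erase x \ A) x) := by
        rw [hsupp]; exact mk_mem_pairs.2 ⟨hRS u hu, hRS _ hbR, huv⟩
      rw [hf₁.1 _ hp, hf₂.1 _ hp]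
    have e₁ := hf₁'.adj_iff hS' hx' hA₁ (hRS' u hu) (hRS' _ hbR) huv
    have e₂ := hf₂'.adj_iff hS' hx' hA₂ (hRS' u hu) (hRS' _ hbR) huv
    rw [e] at e₁
    have := e₁.symm.trans e₂
    rw [hb'] at this
    by_cases h : b ∈ A₂ <;> simpa only [h, iff_true, iff_false, not_iff_not] using this
  ext u
  by_cases huS : u ∈ S
  · by_cases huS' : u ∈ S'.erase x'
    · exact hmem u (mem_erase.2 ⟨ne_of_mem_erase huS',
        mem_inter.2 ⟨huS, mem_of_mem_erase huS'⟩⟩)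
    · exact iff_of_false (fun h => huS' ((mem_powersetCard.1 hA₁).1 h))
        fun h => huS' ((mem_powersetCard.1 hA₂).1 h)
  · have := Finset.ext_iff.1 hd u
    simpa [huS] using this

lemma half_pow_union_eq {S S' : Finset V} {s : ℕ} (hS : #S = s) (hS' : #S' = s) :
    (1 / 2 : ℝ) ^ #(pairs S ∪ pairs S') =
      (1 / 2) ^ (2 * s.choose 2) * 2 ^ (#(S ∩ S')).choose 2 := by
  have h := card_pairs_union S S'
  rw [hS, hS', ← two_mul] at h
  rw [← h, pow_add, mul_assoc, ← mul_pow]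
  norm_num

/-- Joint probability of two configurations, using only domination by the first. -/
lemma pr_present_and_le [Fintype V] {m : ℕ} {S A S' A' : Finset V} {x x' : V} (hS : #S = 2 * m + 1)
    (hx : x ∈ S) (hA : A ∈ powersetCard m (S.erase x)) (hS' : #S' = 2 * m + 1) (hx' : x' ∈ S')
    (hA' : A' ∈ powersetCard m (S'.erase x')) :
    pr (fun f => Present S x A f ∧ Present S' x' A' f) ≤
      (1 / 2) ^ (2 * (2 * m + 1).choose 2) * 2 ^ (#(S ∩ S')).choose 2 *
        exp (-(2 * (1 / 2) ^ m * (Fintype.card V - 2 * (2 * m + 1)))) := by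
  obtain ⟨h1, h2, h3, h4, h5, h6⟩ := config_facts hS hx hA
  obtain ⟨h1', h2', h3', h4', h5', h6'⟩ := config_facts hS' hx' hA'
  have hm := half_pow_le_one m
  refine (pr_good_and_good_le (D := (1 - (1 / 2) ^ m) * (1 - (1 / 2) ^ m))
    (q := fun v f => ¬ Missed v A f ∧ ¬ Missed v (S.erase x \ A) f)
    (fun v => dep_not_missed_two v ((left_subset_supp A _ x).trans subset_union_left)
      ((right_subset_supp A _ x).trans subset_union_left))
    (fun v => (pr_not_missed_two v h3).trans_le (by rw [h1, h2])) (fun v f h _ => h)).trans ?_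
  rw [h6, h6', half_pow_union_eq hS hS']
  gcongr
  have hle : (1 - (1 / 2 : ℝ) ^ m) * (1 - (1 / 2) ^ m) ≤ exp (-(2 * (1 / 2) ^ m)) := by
    have := one_sub_le_exp_neg ((1 / 2 : ℝ) ^ m)
    calc (1 - (1 / 2 : ℝ) ^ m) * (1 - (1 / 2) ^ m)
        ≤ exp (-(1 / 2) ^ m) * exp (-(1 / 2) ^ m) := by
          gcongr
      _ = _ := by rw [← exp_add]; ring_nf
  refine (pow_le_pow_left₀ (mul_self_nonneg _) hle _).trans ?_
  rw [← exp_nat_mul, exp_le_exp]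
  have hW : #(S ∪ S') ≤ 2 * (2 * m + 1) := (card_union_le _ _).trans (by omega)
  have hc : (Fintype.card V : ℝ) - 2 * (2 * m + 1) ≤ (Fintype.card V - #(S ∪ S') : ℕ) := by
    rw [sub_le_iff_le_add]
    have : Fintype.card V ≤ (Fintype.card V - #(S ∪ S')) + 2 * (2 * m + 1) := by omega
    exact_mod_cast this
  have : (0 : ℝ) ≤ 2 * (1 / 2) ^ m := by positivity
  nlinarith

/-- Joint probability of two configurations with small overlap. -/
lemma pr_present_and_le_of_small [Fintype V] {m : ℕ} {S A S' A' : Finset V} {x x' : V}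
    (hS : #S = 2 * m + 1) (hx : x ∈ S) (hA : A ∈ powersetCard m (S.erase x))
    (hS' : #S' = 2 * m + 1) (hx' : x' ∈ S') (hA' : A' ∈ powersetCard m (S'.erase x'))
    (hr : #(S ∩ S') ≤ m / 2) :
    pr (fun f => Present S x A f ∧ Present S' x' A' f) ≤
      (1 / 2) ^ (2 * (2 * m + 1).choose 2) * (2 ^ (m / 4)) ^ #(S ∩ S') *
        exp (-(4 * (1 / 2) ^ m * (Fintype.card V - 2 * (2 * m + 1))) +
          6 * (1 / 2) ^ (2 * m - m / 2) * Fintype.card V) := by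
  obtain ⟨h1, h2, h3, h4, h5, h6⟩ := config_facts hS hx hA
  obtain ⟨h1', h2', h3', h4', h5', h6'⟩ := config_facts hS' hx' hA'
  set B := S.erase x \ A with hB
  set B' := S'.erase x' \ A' with hB'
  have sA : A ⊆ S := (mem_powersetCard.1 hA).1.trans (erase_subset _ _)
  have sB : B ⊆ S := sdiff_subset.trans (erase_subset _ _)
  have sA' : A' ⊆ S' := (mem_powersetCard.1 hA').1.trans (erase_subset _ _)
  have sB' : B' ⊆ S' := sdiff_subset.trans (erase_subset _ _)
  have hw {Y Z : Finset V} (hY : #Y = m) (hZ : #Z = m) (h : #(Y ∩ Z) ≤ m / 2) :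
      (1 / 2 : ℝ) ^ #(Y ∪ Z) ≤ (1 / 2) ^ (2 * m - m / 2) := by
    refine pow_le_pow_of_le_one (by norm_num) (by norm_num) ?_
    have := card_union_add_card_inter Y Z
    omega
  have hcross {Y Z : Finset V} (hY : #Y = m) (hZ : #Z = m) (sY : Y ⊆ S) (sZ : Z ⊆ S') :
      (1 / 2 : ℝ) ^ #(Y ∪ Z) ≤ (1 / 2) ^ (2 * m - m / 2) :=
    hw hY hZ ((card_le_card (inter_subset_inter sY sZ)).trans hr)
  have hD (v : V) := pr_not_missed_four_le v h1 h2 h1' h2'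
    (hw h1 h2 (by rw [disjoint_iff_inter_eq_empty.1 h3, card_empty]; omega))
    (hcross h1 h1' sA sA') (hcross h1 h2' sA sB') (hcross h2 h1' sB sA')
    (hcross h2 h2' sB sB')
    (hw h1' h2' (by rw [disjoint_iff_inter_eq_empty.1 h3', card_empty]; omega))
  have hD0 := (pr_nonneg _).trans (hD x)
  refine (pr_good_and_good_le (D := 1 - 4 * (1 / 2) ^ m + 6 * (1 / 2) ^ (2 * m - m / 2))
    (q := fun v f => (¬ Missed v A f ∧ ¬ Missed v B f) ∧ ¬ Missed v A' f ∧ ¬ Missed v B' f)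
    (fun v => ?_) hD (fun v f h h' => ⟨h, h'⟩)).trans ?_
  · have d1 := dep_not_missed_two v ((left_subset_supp A B x).trans
      (subset_union_left (s₂ := supp A' B' x'))) ((right_subset_supp A B x).trans
      (subset_union_left (s₂ := supp A' B' x')))
    have d2 := dep_not_missed_two v ((left_subset_supp A' B' x').trans
      (subset_union_right (s₁ := supp A B x))) ((right_subset_supp A' B' x').trans
      (subset_union_right (s₁ := supp A B x)))
    exact (d1.and d2).mono (union_self _).subset
  rw [h6, h6', half_pow_union_eq hS hS']
  have hpow : (2 : ℝ) ^ (#(S ∩ S')).choose 2 ≤ (2 ^ (m / 4)) ^ #(S ∩ S') := by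
    rw [← pow_mul]
    refine pow_le_pow_right₀ (by norm_num) ?_
    rw [Nat.choose_two_right]
    generalize #(S ∩ S') = r at *
    have : r - 1 ≤ 2 * (m / 4) := by omega
    refine Nat.div_le_of_le_mul ?_
    calc r * (r - 1) ≤ r * (2 * (m / 4)) := Nat.mul_le_mul_left _ this
      _ = _ := by ring
  gcongr
  have hle : 1 - 4 * (1 / 2 : ℝ) ^ m + 6 * (1 / 2) ^ (2 * m - m / 2) ≤
      exp (-(4 * (1 / 2) ^ m) + 6 * (1 / 2) ^ (2 * m - m / 2)) := by
    have := add_one_le_exp (-(4 * (1 / 2 : ℝ) ^ m) + 6 * (1 / 2) ^ (2 * m - m / 2))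
    linarith
  refine (pow_le_pow_left₀ hD0 hle _).trans ?_
  rw [← exp_nat_mul, exp_le_exp]
  have hW : #(S ∪ S') ≤ 2 * (2 * m + 1) := (card_union_le _ _).trans (by omega)
  have hc : (Fintype.card V : ℝ) - 2 * (2 * m + 1) ≤ (Fintype.card V - #(S ∪ S') : ℕ) := by
    rw [sub_le_iff_le_add]
    have : Fintype.card V ≤ (Fintype.card V - #(S ∪ S')) + 2 * (2 * m + 1) := by omega
    exact_mod_cast this
  have hc' : ((Fintype.card V - #(S ∪ S') : ℕ) : ℝ) ≤ Fintype.card V := by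
    exact_mod_cast Nat.sub_le _ _
  have e1 : (0 : ℝ) ≤ 4 * (1 / 2) ^ m := by positivity
  have e2 : (0 : ℝ) ≤ 6 * (1 / 2) ^ (2 * m - m / 2) := by positivity
  nlinarith

end SecondMoment

section OverlapSum

variable {V : Type*} [Fintype V] [DecidableEq V]

lemma sum_inter_le {s : ℕ} {S : Finset V} (hS : #S = s) {g : ℕ → ℝ} (hg : ∀ r, 0 ≤ g r) :
    ∑ S' ∈ powersetCard s univ, g #(S ∩ S') ≤
      ∑ r ∈ range (s + 1), s.choose r * (Fintype.card V).choose (s - r) * g r := by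
  have hmaps : ∀ S' ∈ powersetCard s (univ : Finset V), #(S ∩ S') ∈ range (s + 1) := fun S' _ =>
    mem_range.2 (Nat.lt_succ_of_le (hS ▸ card_le_card inter_subset_left))
  rw [← sum_fiberwise_of_maps_to hmaps]
  refine sum_le_sum fun r _ => ?_
  rw [sum_congr rfl fun S' hS' => by rw [(mem_filter.1 hS').2], sum_const, nsmul_eq_mul]
  refine mul_le_mul_of_nonneg_right ?_ (hg r)
  have hcard : #(powersetCard r S ×ˢ powersetCard (s - r) (univ : Finset V)) =
      s.choose r * (Fintype.card V).choose (s - r) := by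
    rw [card_product, card_powersetCard, card_powersetCard, hS, card_univ]
  rw [← Nat.cast_mul, ← hcard, Nat.cast_le]
  refine card_le_card_of_injOn (fun S' => (S ∩ S', S' \ S)) (fun S' hS' => ?_)
    (fun S₁ _ S₂ _ heq => ?_)
  · obtain ⟨h1, h2⟩ := mem_filter.1 (mem_coe.1 hS')
    have h1 := (mem_powersetCard.1 h1).2
    refine mem_coe.2 (mem_product.2 ⟨mem_powersetCard.2 ⟨inter_subset_left, h2⟩,
      mem_powersetCard.2 ⟨subset_univ _, ?_⟩⟩)
    rw [card_sdiff, h1, h2]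
  · obtain ⟨h1, h2⟩ := Prod.mk.inj heq
    rw [← Finset.sdiff_union_inter S₁ S, ← Finset.sdiff_union_inter S₂ S, inter_comm S₁,
      inter_comm S₂, h1, h2]

/-- Probability that a fixed configuration on `2 * m + 1` of `n` vertices is present. -/
noncomputable def presentProb (n m : ℕ) : ℝ :=
  (1 / 2) ^ (2 * m + 1).choose 2 * ((1 - (1 / 2) ^ m) * (1 - (1 / 2) ^ m)) ^ (n - (2 * m + 1))

/-- Bound for the total joint probability of a fixed configuration and of all configurations whose
support is a fixed set meeting its support in `r` vertices. -/
noncomputable def overlapBound (n m r : ℕ) : ℝ :=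
  if r ≤ m / 2 then
    ((2 * m + 1) * (2 * m).choose m) * ((1 / 2) ^ (2 * (2 * m + 1).choose 2) * (2 ^ (m / 4)) ^ r *
      exp (-(4 * (1 / 2) ^ m * (n - 2 * (2 * m + 1))) + 6 * (1 / 2) ^ (2 * m - m / 2) * n))
  else if r < 2 * m + 1 then
    ((2 * m + 1) * (2 * 2 ^ (2 * m + 1 - r))) * ((1 / 2) ^ (2 * (2 * m + 1).choose 2) *
      2 ^ r.choose 2 * exp (-(2 * (1 / 2) ^ m * (n - 2 * (2 * m + 1)))))
  else 2 * presentProb n m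

lemma presentProb_nonneg (n m : ℕ) : 0 ≤ presentProb n m :=
  mul_nonneg (by positivity) (pow_nonneg (mul_self_nonneg _) _)

lemma overlapBound_nonneg (n m r : ℕ) : 0 ≤ overlapBound n m r := by
  have := presentProb_nonneg n m
  unfold overlapBound
  split_ifs <;> positivity

lemma sum_compatible_le {m : ℕ} {S A S' : Finset V} {x x' : V} (hS : #S = 2 * m + 1)
    (hx : x ∈ S) (hA : A ∈ powersetCard m (S.erase x)) (hS' : #S' = 2 * m + 1) (hx' : x' ∈ S')
    {B : ℝ} (hB0 : 0 ≤ B) (hB : ∀ A' ∈ powersetCard m (S'.erase x'),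
      pr (fun f => Present S x A f ∧ Present S' x' A' f) ≤ B) :
    ∑ A' ∈ powersetCard m (S'.erase x'), pr (fun f => Present S x A f ∧ Present S' x' A' f) ≤
      (2 * 2 ^ #(S' \ S)) * B := by
  classical
  rw [← sum_filter_of_ne (p := fun A' => ∃ f, Present S x A f ∧ Present S' x' A' f)
    fun A' _ hne => by
      by_contra hc
      exact hne (pr_eq_zero fun f hf => hc ⟨f, hf⟩)]
  refine (sum_le_card_nsmul _ _ B fun A' hA' => hB A' (mem_filter.1 hA').1).trans ?_
  rw [nsmul_eq_mul]
  refine mul_le_mul_of_nonneg_right ?_ hB0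
  exact_mod_cast (by convert card_compatible_le hS hx hA hS' hx')

/-- Total joint probability of a fixed configuration and all configurations with given support. -/
lemma sum_present_and_le {m : ℕ} (hm : 1 ≤ m) {S A S' : Finset V} {x : V} (hS : #S = 2 * m + 1)
    (hx : x ∈ S) (hA : A ∈ powersetCard m (S.erase x)) (hS' : #S' = 2 * m + 1) :
    ∑ x' ∈ S', ∑ A' ∈ powersetCard m (S'.erase x'),
      pr (fun f => Present S x A f ∧ Present S' x' A' f) ≤
    overlapBound (Fintype.card V) m #(S ∩ S') := by
  unfold overlapBound
  split_ifs with h1 h2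
  · have h (x' : V) (hx' : x' ∈ S') := sum_le_card_nsmul _ _ _ fun A' hA' =>
      pr_present_and_le_of_small hS hx hA hS' hx' hA' h1
    refine (sum_le_sum h).trans_eq ?_
    rw [sum_congr rfl fun x' hx' => by
      rw [card_powersetCard, card_erase_of_mem hx', hS', Nat.add_sub_cancel], sum_const, hS',
      nsmul_eq_mul, nsmul_eq_mul]
    push_cast
    ring
  · have h (x' : V) (hx' : x' ∈ S') := sum_compatible_le hS hx hA hS' hx' (by positivity)
      fun A' hA' => pr_present_and_le hS hx hA hS' hx' hA'
    refine (sum_le_sum h).trans_eq ?_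
    rw [sum_const, hS', nsmul_eq_mul, card_sdiff, hS']
    push_cast
    ring
  · have hSS : S' = S := by
      have e : S ∩ S' = S := eq_of_subset_of_card_le inter_subset_left (by omega)
      exact (eq_of_subset_of_card_le (inter_eq_left.1 e) (by omega)).symm
    subst hSS
    rw [sum_eq_single_of_mem x hx fun x' hx' hne => sum_eq_zero fun A' hA' => pr_eq_zero
      fun f hf => hne (center_eq hm hS hx hA hx' hA' hf.1 hf.2)]
    refine (sum_compatible_le hS hx hA hS hx (presentProb_nonneg (Fintype.card V) m)
      fun A' _ => (pr_mono fun f hf => hf.1).trans_eq (pr_present hS hx hA)).trans_eq ?_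
    simp

/-- The second moment bound for the number of configurations. -/
lemma sum_configs_le {m : ℕ} (hm : 1 ≤ m) :
    ∑ c ∈ configs V m, ∑ c' ∈ configs V m,
      pr (fun f => Present c.1 c.2.1 c.2.2 f ∧ Present c'.1 c'.2.1 c'.2.2 f) ≤
    #(configs V m) * ∑ r ∈ range (2 * m + 1 + 1), (2 * m + 1).choose r *
      (Fintype.card V).choose (2 * m + 1 - r) * overlapBound (Fintype.card V) m r := by
  rw [← nsmul_eq_mul]
  refine sum_le_card_nsmul _ _ _ fun ⟨S, x, A⟩ hc => ?_
  obtain ⟨hS, hc⟩ := mem_sigma.1 hc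
  obtain ⟨hx, hA⟩ := mem_sigma.1 hc
  have hS := (mem_powersetCard.1 hS).2
  refine le_trans ?_ (sum_inter_le hS (overlapBound_nonneg (Fintype.card V) m))
  rw [configs, sum_sigma]
  refine sum_le_sum fun S' hS' => ?_
  rw [sum_sigma]
  exact sum_present_and_le hm hS hx hA (mem_powersetCard.1 hS').2

end OverlapSum

/-- The second moment method for `PropertyP`. -/
lemma sq_le_unifProb_mul {m : ℕ} (hm : 1 ≤ m) (n : ℕ) :
    (#(configs (Fin n) m) * presentProb n m) ^ 2 ≤
      unifProb n PropertyP * (#(configs (Fin n) m) * ∑ r ∈ range (2 * m + 1 + 1),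
        (2 * m + 1).choose r * n.choose (2 * m + 1 - r) * overlapBound n m r) := by
  have h := sq_le_pr_mul (configs (Fin n) m) fun c => Present c.1 c.2.1 c.2.2
  have hsum := sum_configs_le (V := Fin n) hm
  rw [Fintype.card_fin] at hsum
  have hcf (c) (hc : c ∈ configs (Fin n) m) : #c.1 = 2 * m + 1 ∧ c.2.1 ∈ c.1 ∧
      c.2.2 ∈ powersetCard m (c.1.erase c.2.1) := by
    obtain ⟨hS, hc⟩ := mem_sigma.1 hc
    obtain ⟨hx, hA⟩ := mem_sigma.1 hc
    exact ⟨(mem_powersetCard.1 hS).2, hx, hA⟩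
  rw [sum_congr rfl fun c hc => pr_present (hcf c hc).1 (hcf c hc).2.1 (hcf c hc).2.2,
    sum_const, nsmul_eq_mul, Fintype.card_fin] at h
  refine h.trans ?_
  rw [unifProb_eq_pr]
  refine mul_le_mul (pr_mono fun f ⟨c, hc, hf⟩ => ?_) hsum
    (sum_nonneg fun _ _ => sum_nonneg fun _ _ => pr_nonneg _) (pr_nonneg _)
  obtain ⟨hS, hx, hA⟩ := hcf c hc
  obtain ⟨h1, h2, h3, h4, h5, -⟩ := config_facts hS hx hA
  exact ⟨_, _, _, (isConfig_graphOf_iff f _ _ _).2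
    ⟨⟨card_pos.1 (by omega), card_pos.1 (by omega), h3, h4, h5⟩, hf⟩⟩

lemma choose_sub_mul_pow_le {n s r : ℕ} (hr : r ≤ s) :
    n.choose (s - r) * (n - s) ^ r ≤ n.choose s * s ^ r := by
  induction r with
  | zero => simp
  | succ r ih =>
    have h := Nat.choose_succ_right_eq n (s - (r + 1))
    rw [show s - (r + 1) + 1 = s - r by omega] at h
    calc n.choose (s - (r + 1)) * (n - s) ^ (r + 1)
        = n.choose (s - (r + 1)) * (n - s) * (n - s) ^ r := by ring
      _ ≤ n.choose (s - (r + 1)) * (n - (s - (r + 1))) * (n - s) ^ r := by gcongr; omega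
      _ = n.choose (s - r) * (n - s) ^ r * (s - r) := by rw [← h]; ring
      _ ≤ n.choose s * s ^ r * s :=
          Nat.mul_le_mul (ih (by omega)) (by omega)
      _ = _ := by ring

lemma sum_choose_mul_pow_le {n s M : ℕ} (h : s ^ 2 * M + s ≤ n) (hs : 0 < s) (hM : 0 < M) :
    ∑ r ∈ range (s + 1), (s.choose r * n.choose (s - r) * M ^ r : ℝ) ≤ exp 1 * n.choose s := by
  have hns : 0 < n - s := by
    have : 0 < s ^ 2 * M := by positivity
    omega
  have hns' : (0 : ℝ) < (n - s : ℕ) := by exact_mod_cast hns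
  have hterm : ∀ r ∈ range (s + 1), (s.choose r * n.choose (s - r) * M ^ r : ℝ) ≤
      n.choose s * ((s * M / (n - s : ℕ)) ^ r * 1 ^ (s - r) * s.choose r) := by
    intro r hr
    have h1 : (n.choose (s - r) * (n - s : ℕ) ^ r : ℝ) ≤ n.choose s * s ^ r := by
      exact_mod_cast choose_sub_mul_pow_le (n := n) (Nat.lt_succ_iff.1 (mem_range.1 hr))
    rw [one_pow, mul_one, div_pow, mul_pow]
    have h2 : (n.choose (s - r) : ℝ) ≤ n.choose s * s ^ r / (n - s : ℕ) ^ r := by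
      rwa [le_div_iff₀ (by positivity)]
    calc (s.choose r * n.choose (s - r) * M ^ r : ℝ)
        ≤ s.choose r * (n.choose s * s ^ r / (n - s : ℕ) ^ r) * M ^ r := by gcongr
      _ = _ := by ring
  refine (sum_le_sum hterm).trans ?_
  rw [← mul_sum, ← add_pow, mul_comm]
  gcongr
  refine (pow_le_pow_left₀ (by positivity) (add_one_le_exp _) s).trans ?_
  rw [← exp_nat_mul, exp_le_exp, mul_div_assoc', div_le_one hns']
  have : s * (s * M) ≤ n - s := by rw [← mul_assoc, ← sq]; omega
  exact_mod_cast this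

/-- The parameters of the second moment computation. -/
structure Params (n L m : ℕ) : Prop where
  one_le : 1 ≤ m
  le : m ≤ L
  large : 128 * L ^ 4 ≤ 2 ^ (m / 4)
  eq : n = 2 ^ m * L

/-- The probability that a fixed configuration is present, up to a bounded factor. -/
noncomputable def weight (m L : ℕ) : ℝ := (1 / 2) ^ (2 * m + 1).choose 2 * exp (-(2 * L))

namespace Params

variable {n L m : ℕ}

lemma pos (h : Params n L m) : 1 ≤ L := h.one_le.trans h.le

lemma size_le (h : Params n L m) : 2 * m + 1 ≤ 3 * L := by
  have := h.le; have := h.pos; omega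

lemma pow_le (h : Params n L m) : (2 ^ (m / 4)) ^ 4 * L ≤ n := by
  rw [h.eq, ← pow_mul]
  exact Nat.mul_le_mul_right _ (Nat.pow_le_pow_right (by norm_num) (by omega))

lemma sq_mul_le (h : Params n L m) : 100 * (2 * m + 1) ^ 2 * 2 ^ (m / 4) ≤ n := by
  have h1 := h.pow_le
  have h2 := h.large
  have h3 := h.size_le
  have h4 := h.pos
  generalize 2 ^ (m / 4) = M at *
  calc 100 * (2 * m + 1) ^ 2 * M ≤ 100 * (3 * L) ^ 2 * M := by gcongr
    _ = 900 * (L ^ 2 * 1) * M := by ring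
    _ ≤ 16384 * (L ^ 2 * L ^ 6) * M := by
      gcongr
      · norm_num
      · exact Nat.one_le_pow _ _ h4
    _ = (128 * L ^ 4) ^ 2 * 1 * M := by ring
    _ ≤ M ^ 2 * (M * L) * M := by
      gcongr
      have : 1 ≤ M := le_trans (by have : 0 < L ^ 4 := by positivity
                                   omega) h2
      exact Nat.one_le_iff_ne_zero.2 (by positivity)
    _ = M ^ 4 * L := by ring
    _ ≤ n := h1

lemma half_pow_mul (h : Params n L m) : (1 / 2 : ℝ) ^ m * n = L := by
  rw [h.eq]; push_cast
  rw [← mul_assoc, ← mul_pow]; norm_num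

lemma half_pow_mul_le (h : Params n L m) : 100 * ((2 * m + 1) * (1 / 2 : ℝ) ^ m) ≤ 1 := by
  have h1 : (100 * (2 * m + 1) ^ 2 * 2 ^ (m / 4) : ℝ) ≤ n := by exact_mod_cast h.sq_mul_le
  have h2 : (L : ℝ) ≤ 2 ^ (m / 4) := by
    have h2 : (128 * L ^ 4 : ℝ) ≤ 2 ^ (m / 4) := by exact_mod_cast h.large
    have h3 : (1 : ℝ) ≤ L := by exact_mod_cast h.pos
    have h4 : (1 : ℝ) ≤ L ^ 3 := one_le_pow₀ h3
    nlinarith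
  have h3 : (0 : ℝ) < L := by exact_mod_cast h.pos
  have h4 := h.half_pow_mul
  have h5 : (0 : ℝ) < (1 / 2) ^ m := by positivity
  have h6 : (1 : ℝ) ≤ 2 * m + 1 := by have : (0 : ℝ) ≤ m := by positivity
                                      linarith
  have h7 : (100 * (2 * m + 1) * L : ℝ) ≤ n := by
    refine le_trans ?_ h1
    gcongr
    nlinarith
  have h8 := mul_le_mul_of_nonneg_left h7 h5.le
  rw [h4] at h8
  nlinarith

lemma presentProb_le (h : Params n L m) : presentProb n m ≤ weight m L * exp 1 := by
  have hu := half_pow_le_one m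
  have hsmall := h.half_pow_mul_le
  have hun := h.half_pow_mul
  have hu0 : (0 : ℝ) < (1 / 2) ^ m := by positivity
  unfold presentProb weight
  rw [mul_assoc, ← exp_add]
  gcongr
  have hle : (1 - (1 / 2 : ℝ) ^ m) * (1 - (1 / 2) ^ m) ≤ exp (-(2 * (1 / 2) ^ m)) := by
    have := one_sub_le_exp_neg ((1 / 2 : ℝ) ^ m)
    calc (1 - (1 / 2 : ℝ) ^ m) * (1 - (1 / 2) ^ m)
        ≤ exp (-(1 / 2) ^ m) * exp (-(1 / 2) ^ m) := by gcongr
      _ = _ := by rw [← exp_add]; ring_nf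
  refine (pow_le_pow_left₀ (mul_self_nonneg _) hle _).trans ?_
  rw [← exp_nat_mul, exp_le_exp]
  have hc : (n : ℝ) ≤ (n - (2 * m + 1) : ℕ) + (2 * m + 1) := by
    have : n ≤ (n - (2 * m + 1)) + (2 * m + 1) := by omega
    exact_mod_cast this
  nlinarith

lemma mul_half_pow_le (h : Params n L m) : (2 * L + 1) * (1 / 2 : ℝ) ^ m ≤ 1 := by
  have h1 : 128 * L ^ 2 ≤ n := by
    have h1 := h.pow_le
    have h2 := h.large
    have h4 := h.pos
    generalize 2 ^ (m / 4) = M at *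
    calc 128 * L ^ 2 = 128 * (L * 1) * L := by ring
      _ ≤ 128 * (L * L ^ 3) * L := by gcongr; exact Nat.one_le_pow _ _ h4
      _ = 128 * L ^ 4 * L := by ring
      _ ≤ M ^ 4 * L := by gcongr; exact h2.trans (Nat.le_self_pow (by norm_num) _)
      _ ≤ n := h1
  have h2 : (128 * L ^ 2 : ℝ) ≤ n := by exact_mod_cast h1
  have h3 : (1 : ℝ) ≤ L := by exact_mod_cast h.pos
  have h4 := h.half_pow_mul
  have h5 : (0 : ℝ) < (1 / 2) ^ m := by positivity
  have h6 := mul_le_mul_of_nonneg_left h2 h5.le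
  rw [h4] at h6
  nlinarith

lemma le_presentProb (h : Params n L m) : weight m L * exp (-1) ≤ presentProb n m := by
  have hsmall := h.mul_half_pow_le
  have hun := h.half_pow_mul
  have hL : (1 : ℝ) ≤ L := by exact_mod_cast h.pos
  have hu0 : (0 : ℝ) < (1 / 2) ^ m := by positivity
  unfold presentProb weight
  rw [mul_assoc, ← exp_add]
  generalize (1 / 2 : ℝ) ^ m = u at *
  have hu1 : 0 < 1 - u := by nlinarith
  gcongr
  have hlog := one_sub_inv_le_log_of_pos hu1
  have hexp : exp (1 - (1 - u)⁻¹) ≤ 1 - u := (exp_le_exp.2 hlog).trans_eq (exp_log hu1)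
  have hle : exp (2 * (1 - (1 - u)⁻¹)) ≤ (1 - u) * (1 - u) := by
    rw [two_mul, exp_add]
    gcongr
  calc exp (-(2 * L) + -1) ≤ exp (2 * (1 - (1 - u)⁻¹)) ^ n := by
        rw [← exp_nat_mul, exp_le_exp]
        have e : (n : ℝ) * (2 * (1 - (1 - u)⁻¹)) = -(2 * L) / (1 - u) := by
          rw [← hun]; field_simp; ring
        rw [e, le_div_iff₀ hu1]
        nlinarith
    _ ≤ ((1 - u) * (1 - u)) ^ n := by gcongr
    _ ≤ ((1 - u) * (1 - u)) ^ (n - (2 * m + 1)) :=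
        pow_le_pow_of_le_one (by positivity) (by nlinarith) (Nat.sub_le _ _)

/-- The exponential factor in `overlapBound` for small overlaps. -/
lemma exp_small_le (h : Params n L m) :
    exp (-(4 * (1 / 2) ^ m * (n - 2 * (2 * m + 1))) + 6 * (1 / 2) ^ (2 * m - m / 2) * n) ≤
      exp (-(2 * L)) * exp (-(2 * L)) * exp 2 := by
  rw [← exp_add, ← exp_add, exp_le_exp]
  have hsmall := h.half_pow_mul_le
  have hun := h.half_pow_mul
  have h2 : (6 * L : ℝ) ≤ 2 ^ (m / 4) := by
    have h2 : (128 * L ^ 4 : ℝ) ≤ 2 ^ (m / 4) := by exact_mod_cast h.large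
    have h3 : (1 : ℝ) ≤ L := by exact_mod_cast h.pos
    have h4 : (1 : ℝ) ≤ L ^ 3 := one_le_pow₀ h3
    nlinarith
  have h3 : 6 * (1 / 2 : ℝ) ^ (2 * m - m / 2) * n ≤ 1 := by
    calc 6 * (1 / 2 : ℝ) ^ (2 * m - m / 2) * n ≤ 6 * (1 / 2 : ℝ) ^ (m + m / 4) * n := by
          gcongr ?_ * ?_ * ?_
          exact pow_le_pow_of_le_one (by norm_num) (by norm_num) (by omega)
      _ = 6 * ((1 / 2) ^ m * n) * (1 / 2) ^ (m / 4) := by rw [pow_add]; ring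
      _ = 6 * L * (1 / 2) ^ (m / 4) := by rw [hun]
      _ ≤ 2 ^ (m / 4) * (1 / 2) ^ (m / 4) := by gcongr
      _ = 1 := by rw [← mul_pow]; norm_num
  nlinarith

/-- The exponential factor in `overlapBound` for large overlaps. -/
lemma exp_large_le (h : Params n L m) :
    exp (-(2 * (1 / 2) ^ m * (n - 2 * (2 * m + 1)))) ≤ exp (-(2 * L)) * exp 1 := by
  rw [← exp_add, exp_le_exp]
  have hsmall := h.half_pow_mul_le
  have hun := h.half_pow_mul
  nlinarith

/-- The total contribution of a large overlap `r` is negligible. -/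
lemma choose_mul_large_le (h : Params n L m) {r : ℕ} (hr : m / 2 < r) (hrs : r < 2 * m + 1) :
    ((2 * m + 1).choose r * n.choose (2 * m + 1 - r) * (((2 * m + 1) * (2 * 2 ^ (2 * m + 1 - r))) *
      ((1 / 2) ^ (2 * m + 1).choose 2 * 2 ^ r.choose 2)) : ℝ) ≤ 1 / (2 * m + 1) := by
  obtain ⟨q, hq⟩ : ∃ q, q = 2 * m + 1 - r := ⟨_, rfl⟩
  have hq1 : 1 ≤ q := by omega
  rw [← hq]
  have hs : ((2 * m + 1 : ℕ) : ℝ) = 2 * m + 1 := by push_cast; ring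
  have c1 : ((2 * m + 1).choose r : ℝ) ≤ (2 * m + 1) ^ q := by
    rw [← hs, ← Nat.choose_symm hrs.le, ← hq]
    exact_mod_cast Nat.choose_le_pow _ _
  have c2 : (n.choose q : ℝ) ≤ n ^ q := by exact_mod_cast Nat.choose_le_pow _ _
  have c3 : (1 / 2 : ℝ) ^ (2 * m + 1).choose 2 * 2 ^ r.choose 2 ≤
      (1 / 2) ^ (q * (m + m / 4)) := by
    have hchoose : q * (m + m / 4) + r.choose 2 ≤ (2 * m + 1).choose 2 := by
      have h1 : 2 * (m + m / 4) ≤ 2 * m + r := by omega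
      have h1 : (2 * (m + (m / 4 : ℕ)) : ℝ) ≤ 2 * m + r := by exact_mod_cast h1
      have h2 : (q + r : ℝ) = 2 * m + 1 := by
        have : q + r = 2 * m + 1 := by omega
        exact_mod_cast this
      have h3 : (0 : ℝ) ≤ q := by positivity
      suffices (q * (m + (m / 4 : ℕ)) + (r.choose 2 : ℝ) : ℝ) ≤ ((2 * m + 1).choose 2 : ℕ) by
        exact_mod_cast this
      rw [Nat.cast_choose_two, Nat.cast_choose_two, hs, ← h2]
      nlinarith
    calc (1 / 2 : ℝ) ^ (2 * m + 1).choose 2 * 2 ^ r.choose 2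
        ≤ (1 / 2 : ℝ) ^ (q * (m + m / 4) + r.choose 2) * 2 ^ r.choose 2 := by
          gcongr ?_ * _
          exact pow_le_pow_of_le_one (by norm_num) (by norm_num) hchoose
      _ = _ := by rw [pow_add, mul_assoc, ← mul_pow]; norm_num
  set ρ : ℝ := 2 * (2 * m + 1) * L * (1 / 2) ^ (m / 4) with hρ
  have hρ1 : 2 * (2 * m + 1) ^ 2 * ρ ≤ 1 := by
    have h1 : (128 * L ^ 4 : ℝ) ≤ 2 ^ (m / 4) := by exact_mod_cast h.large
    have h2 : (2 * m + 1 : ℝ) ≤ 3 * L := by exact_mod_cast h.size_le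
    calc 2 * (2 * m + 1) ^ 2 * ρ = 4 * (2 * m + 1 : ℝ) ^ 3 * L * (1 / 2) ^ (m / 4) := by
          rw [hρ]; ring
      _ ≤ 4 * (3 * L : ℝ) ^ 3 * L * (1 / 2) ^ (m / 4) := by gcongr
      _ ≤ 128 * L ^ 4 * (1 / 2) ^ (m / 4) := by
        gcongr ?_ * _
        have : (0 : ℝ) ≤ L ^ 4 := by positivity
        linarith
      _ ≤ 2 ^ (m / 4) * (1 / 2) ^ (m / 4) := by gcongr
      _ = 1 := by rw [← mul_pow]; norm_num
  have hm1 : (1 : ℝ) ≤ 2 * m + 1 := by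
    have : (0 : ℝ) ≤ m := by positivity
    linarith
  have hρ0 : 0 ≤ ρ := by positivity
  have hρle : ρ ≤ 1 := by nlinarith
  calc _ ≤ ((2 * m + 1) ^ q * n ^ q * (((2 * m + 1) * (2 * 2 ^ q)) *
        (1 / 2) ^ (q * (m + m / 4))) : ℝ) := by gcongr
    _ = 2 * (2 * m + 1) * (2 * (2 * m + 1) * ((1 / 2) ^ m * n) * (1 / 2) ^ (m / 4)) ^ q := by
      rw [mul_comm q, pow_mul, pow_add, ← hs]
      simp only [mul_pow]; ring
    _ = 2 * (2 * m + 1) * ρ ^ q := by rw [h.half_pow_mul]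
    _ ≤ 2 * (2 * m + 1) * ρ := by
      gcongr
      exact pow_le_of_le_one hρ0 hρle (by omega)
    _ ≤ _ := by rw [le_div_iff₀ (by linarith)]; nlinarith

end Params

namespace Params

variable {n L m : ℕ}

lemma sum_overlap_le (h : Params n L m) :
    ∑ r ∈ range (2 * m + 1 + 1), ((2 * m + 1).choose r * n.choose (2 * m + 1 - r) *
      overlapBound n m r : ℝ) ≤
    n.choose (2 * m + 1) * ((2 * m + 1) * (2 * m).choose m) * weight m L ^ 2 * exp 3 +
      weight m L * (3 * exp 1) := by
  have hw : 0 ≤ weight m L := by unfold weight; positivity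
  have hs : ((2 * m + 1 : ℕ) : ℝ) = 2 * m + 1 := by push_cast; ring
  have hs0 : (0 : ℝ) < 2 * m + 1 := by positivity
  set α : ℝ := ((2 * m + 1) * (2 * m).choose m) * (weight m L ^ 2 * exp 2) with hα
  have hα0 : 0 ≤ α := by positivity
  have hsq : weight m L ^ 2 = (1 / 2) ^ (2 * (2 * m + 1).choose 2) *
      (exp (-(2 * L)) * exp (-(2 * L))) := by
    unfold weight; rw [mul_pow, ← pow_mul, mul_comm (Nat.choose _ _) 2, sq (exp _)]
  have hterm : ∀ r ∈ range (2 * m + 1), ((2 * m + 1).choose r * n.choose (2 * m + 1 - r) *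
      overlapBound n m r : ℝ) ≤ α * ((2 * m + 1).choose r * n.choose (2 * m + 1 - r) *
        (2 ^ (m / 4) : ℕ) ^ r) + weight m L * exp 1 * (1 / (2 * m + 1)) := by
    intro r hr
    have hr := mem_range.1 hr
    unfold overlapBound
    split_ifs with h1
    · refine le_add_of_le_of_nonneg ?_ (by positivity)
      calc _ ≤ (2 * m + 1).choose r * n.choose (2 * m + 1 - r) *
            (((2 * m + 1) * (2 * m).choose m) * ((1 / 2) ^ (2 * (2 * m + 1).choose 2) *
              (2 ^ (m / 4)) ^ r * (exp (-(2 * L)) * exp (-(2 * L)) * exp 2))) := by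
            gcongr; exact h.exp_small_le
        _ = _ := by rw [hα, hsq]; push_cast; ring
    · refine le_add_of_nonneg_of_le (by positivity) ?_
      calc _ ≤ (2 * m + 1).choose r * n.choose (2 * m + 1 - r) *
            (((2 * m + 1) * (2 * 2 ^ (2 * m + 1 - r))) * ((1 / 2) ^ (2 * (2 * m + 1).choose 2) *
              2 ^ r.choose 2 * (exp (-(2 * L)) * exp 1))) := by
            gcongr; exact h.exp_large_le
        _ = weight m L * exp 1 * ((2 * m + 1).choose r * n.choose (2 * m + 1 - r) *
            (((2 * m + 1) * (2 * 2 ^ (2 * m + 1 - r))) *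
              ((1 / 2) ^ (2 * m + 1).choose 2 * 2 ^ r.choose 2))) := by
            unfold weight; rw [two_mul ((2 * m + 1).choose 2), pow_add]; ring
        _ ≤ _ := by
            gcongr; exact h.choose_mul_large_le (not_le.1 h1) hr
  have hlast : overlapBound n m (2 * m + 1) ≤ 2 * (weight m L * exp 1) := by
    rw [overlapBound, if_neg (by omega), if_neg (lt_irrefl _)]
    exact mul_le_mul_of_nonneg_left h.presentProb_le (by norm_num)
  have hsum : ∑ r ∈ range (2 * m + 1), ((2 * m + 1).choose r * n.choose (2 * m + 1 - r) *
      (2 ^ (m / 4) : ℕ) ^ r : ℝ) ≤ exp 1 * n.choose (2 * m + 1) := by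
    refine le_trans ?_ (sum_choose_mul_pow_le (M := 2 ^ (m / 4)) (n := n) (s := 2 * m + 1) ?_
      (by omega) (by positivity))
    · exact sum_le_sum_of_subset_of_nonneg (range_mono (Nat.le_succ _))
        fun _ _ _ => by positivity
    · have h1 := h.sq_mul_le
      have h2 : 1 ≤ 2 ^ (m / 4) := Nat.one_le_two_pow
      nlinarith
  rw [sum_range_succ]
  refine (add_le_add (sum_le_sum hterm) (mul_le_mul_of_nonneg_left hlast
    (by positivity))).trans ?_
  rw [sum_add_distrib, ← mul_sum, sum_const, card_range, nsmul_eq_mul, hs, Nat.choose_self,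
    Nat.sub_self, Nat.choose_zero_right]
  have e1 : (2 * m + 1 : ℝ) * (weight m L * exp 1 * (1 / (2 * m + 1))) = weight m L * exp 1 := by
    field_simp
  rw [e1]
  have e2 := mul_le_mul_of_nonneg_left hsum hα0
  have e3 : α * (exp 1 * n.choose (2 * m + 1)) = n.choose (2 * m + 1) *
      ((2 * m + 1) * (2 * m).choose m) * weight m L ^ 2 * exp 3 := by
    rw [hα, show (3 : ℝ) = 2 + 1 by norm_num, exp_add]; ring
  rw [e3] at e2
  simp only [Nat.cast_one]
  linarith

/-- The second moment bound in terms of the normalized number of candidates. -/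
lemma le_unifProb (h : Params n L m) {Q : ℝ} (hQ : 0 < Q)
    (hle : Q ≤ n.choose (2 * m + 1) * ((2 * m + 1) * (2 * m).choose m) * weight m L) :
    Q * exp (-2) ≤ (Q * exp 3 + 3 * exp 1) * unifProb n PropertyP := by
  have h1 := sq_le_unifProb_mul h.one_le n
  have hw : 0 < weight m L := by unfold weight; positivity
  have hp := unifProb_nonneg n PropertyP
  rw [card_configs, Fintype.card_fin] at h1
  push_cast at h1
  set T : ℝ := n.choose (2 * m + 1) * ((2 * m + 1) * (2 * m).choose m) with hT
  have hT0 : 0 < T := by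
    by_contra hc
    nlinarith
  set p := unifProb n PropertyP
  have h2 : T * (weight m L * exp (-1)) ≤ T * presentProb n m := by
    gcongr; exact h.le_presentProb
  have h3 := (pow_le_pow_left₀ (by positivity) h2 2).trans (h1.trans
    (mul_le_mul_of_nonneg_left (mul_le_mul_of_nonneg_left h.sum_overlap_le hT0.le) hp))
  have e : exp (-1) ^ 2 = exp (-2) := by rw [← exp_nat_mul]; norm_num
  set R := T * weight m L with hR
  have hR0 : 0 < R := by positivity
  have h4 : R * (R * exp (-2)) ≤ R * ((R * exp 3 + 3 * exp 1) * p) := by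
    calc R * (R * exp (-2)) = (T * (weight m L * exp (-1))) ^ 2 := by rw [← e]; ring
      _ ≤ _ := h3
      _ = _ := by rw [← hT]; ring
  have h5 := le_of_mul_le_mul_left h4 hR0
  have e1 := exp_pos 1
  have e3 := exp_pos 3
  have h6 : Q * (R * exp (-2)) ≤ R * ((Q * exp 3 + 3 * exp 1) * p) := by
    calc Q * (R * exp (-2)) ≤ Q * ((R * exp 3 + 3 * exp 1) * p) := by gcongr
      _ = Q * R * exp 3 * p + Q * (3 * exp 1 * p) := by ring
      _ ≤ Q * R * exp 3 * p + R * (3 * exp 1 * p) := by gcongr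
      _ = _ := by ring
  refine le_of_mul_le_mul_left ?_ hR0
  linarith

end Params

lemma factorial_sq_le {m : ℕ} (hm : 1 ≤ m) :
    (m.factorial : ℝ) ^ 2 ≤ exp 2 * m * (m / exp 1) ^ (2 * m) := by
  obtain ⟨k, rfl⟩ : ∃ k, m = k + 1 := ⟨m - 1, by omega⟩
  have h1 := Stirling.stirlingSeq'_antitone (Nat.zero_le k)
  simp only [Function.comp_apply, Nat.succ_eq_add_one, zero_add, Stirling.stirlingSeq_one] at h1
  rw [Stirling.stirlingSeq, div_le_iff₀ (by positivity)] at h1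
  refine (pow_le_pow_left₀ (by positivity) h1 2).trans_eq ?_
  have e : exp 2 = exp 1 ^ 2 := by rw [← exp_nat_mul]; norm_num
  rw [mul_pow, div_pow, sq_sqrt (by norm_num), mul_pow, sq_sqrt (by positivity), ← pow_mul,
    mul_comm 2 (k + 1), e]
  ring

lemma half_pow_le_descFactorial {n s : ℕ} (hn : 0 < n) (h : 2 * s ^ 2 ≤ n) :
    (n : ℝ) ^ s / 2 ≤ n.descFactorial s := by
  have hsn : s ≤ n := by nlinarith
  have hn0 : (0 : ℝ) < n := by exact_mod_cast hn
  have h1 : ((n : ℝ) - s) ^ s ≤ n.descFactorial s := by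
    have h2 : (n - s) ^ s ≤ n.descFactorial s :=
      (Nat.pow_le_pow_left (by omega) s).trans (Nat.pow_sub_le_descFactorial n s)
    rw [← Nat.cast_sub hsn]
    exact_mod_cast h2
  have hsn' : (s : ℝ) / n ≤ 1 := div_le_one_of_le₀ (by exact_mod_cast hsn) hn0.le
  have h3 := one_add_mul_le_pow (a := -((s : ℝ) / n)) (by linarith) s
  have h4 : (s : ℝ) * (s / n) ≤ 1 / 2 := by
    have : (2 * s ^ 2 : ℝ) ≤ n := by exact_mod_cast h
    rw [mul_div_assoc', div_le_iff₀ hn0]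
    linarith
  refine le_trans ?_ h1
  calc (n : ℝ) ^ s / 2 = n ^ s * (1 / 2) := by ring
    _ ≤ n ^ s * (1 + -(s / n)) ^ s := by gcongr; linarith
    _ = (n - s) ^ s := by rw [← mul_pow]; congr 1; field_simp; ring

lemma choose_mul_factorial_sq (n m : ℕ) :
    n.choose (2 * m + 1) * ((2 * m + 1) * (2 * m).choose m) * m.factorial ^ 2 =
      n.descFactorial (2 * m + 1) := by
  have h := Nat.choose_mul_factorial_mul_factorial (show m ≤ 2 * m by omega)
  rw [show 2 * m - m = m by omega] at h
  rw [Nat.descFactorial_eq_factorial_mul_choose, Nat.factorial_succ, ← h]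
  ring

lemma pow_mul_exp_ge {L m : ℕ} (hm : 1 ≤ m) (hmL : m ≤ L) (hd : (L - m) ^ 2 ≤ L) :
    exp (-2) * m * (m / exp 1) ^ (2 * m) ≤ (L : ℝ) ^ (2 * m + 1) * exp (-(2 * L)) := by
  have hm0 : (0 : ℝ) < m := by exact_mod_cast hm
  have hmL' : (m : ℝ) ≤ L := by exact_mod_cast hmL
  have hL0 : (0 : ℝ) < L := hm0.trans_le hmL'
  have hd' : ((L : ℝ) - m) ^ 2 ≤ L := by rw [← Nat.cast_sub hmL]; exact_mod_cast hd
  have h1 := one_sub_inv_le_log_of_pos (div_pos hL0 hm0)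
  have h2 : exp (1 - m / L) ≤ L / m := by
    rw [inv_div] at h1
    exact (exp_le_exp.2 h1).trans_eq (exp_log (div_pos hL0 hm0))
  have h3 : (m : ℝ) ^ (2 * m) * exp (2 * m * (1 - m / L)) ≤ (L : ℝ) ^ (2 * m) := by
    have := pow_le_pow_left₀ (exp_pos _).le h2 (2 * m)
    rw [← exp_nat_mul, div_pow, le_div_iff₀ (by positivity), mul_comm] at this
    push_cast at this
    exact this
  have h4 : -2 - 2 * (m : ℝ) ≤ 2 * m * (1 - m / L) - 2 * L := by
    have e : 2 * m * (1 - m / L) - 2 * L + 2 * (m : ℝ) = -2 * ((L - m) ^ 2 / L) := by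
      field_simp; ring
    have : ((L : ℝ) - m) ^ 2 / L ≤ 1 := div_le_one_of_le₀ hd' hL0.le
    linarith
  have e : exp 1 ^ (2 * m) = exp (2 * m) := by rw [← exp_nat_mul]; push_cast; ring_nf
  calc exp (-2) * m * (m / exp 1) ^ (2 * m) = m ^ (2 * m) * exp (-2 - 2 * m) * m := by
        rw [div_pow, e, exp_sub]; ring
    _ ≤ m ^ (2 * m) * exp (2 * m * (1 - m / L) - 2 * L) * L := by gcongr
    _ = m ^ (2 * m) * exp (2 * m * (1 - m / L)) * exp (-(2 * L)) * L := by
        rw [sub_eq_add_neg, exp_add, ← mul_assoc]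
    _ ≤ L ^ (2 * m) * exp (-(2 * L)) * L := by gcongr
    _ = _ := by ring

lemma choose_mul_weight_ge {n L m : ℕ} (h : Params n L m) (hd : (L - m) ^ 2 ≤ L) :
    exp (-4) / 2 ≤ n.choose (2 * m + 1) * ((2 * m + 1) * (2 * m).choose m) * weight m L := by
  have hn : 0 < n := by rw [h.eq]; have := h.pos; positivity
  have hsq : 2 * (2 * m + 1) ^ 2 ≤ n := by
    have h1 := h.sq_mul_le
    have h2 : 1 ≤ 2 ^ (m / 4) := Nat.one_le_two_pow
    nlinarith
  have h1 := half_pow_le_descFactorial hn hsq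
  rw [← choose_mul_factorial_sq] at h1
  push_cast at h1
  set T : ℝ := n.choose (2 * m + 1) * ((2 * m + 1) * (2 * m).choose m) with hT
  have hC : (2 * m + 1).choose 2 = m * (2 * m + 1) := by
    rw [Nat.choose_two_right, Nat.add_sub_cancel]
    exact Nat.div_eq_of_eq_mul_left (by norm_num) (by ring)
  have h2 : (L : ℝ) ^ (2 * m + 1) / 2 ≤ T * (1 / 2) ^ (2 * m + 1).choose 2 * m.factorial ^ 2 := by
    rw [hC, pow_mul]
    calc (L : ℝ) ^ (2 * m + 1) / 2 = ((1 / 2) ^ m) ^ (2 * m + 1) * (n ^ (2 * m + 1) / 2) := by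
          rw [← h.half_pow_mul, mul_pow]; ring
      _ ≤ ((1 / 2) ^ m) ^ (2 * m + 1) * (T * m.factorial ^ 2) := by gcongr
      _ = _ := by ring
  have h3 := pow_mul_exp_ge h.one_le h.le hd
  have h4 := factorial_sq_le h.one_le
  have hf : (0 : ℝ) < m.factorial ^ 2 := by positivity
  have e4 : exp (-4) * exp 2 = exp (-2) := by rw [← exp_add]; norm_num
  refine le_of_mul_le_mul_right ?_ hf
  calc exp (-4) / 2 * m.factorial ^ 2 ≤ exp (-4) / 2 * (exp 2 * m * (m / exp 1) ^ (2 * m)) := by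
        gcongr
    _ = exp (-2) * m * (m / exp 1) ^ (2 * m) / 2 := by rw [← e4]; ring
    _ ≤ (L : ℝ) ^ (2 * m + 1) * exp (-(2 * L)) / 2 := by gcongr
    _ = (L : ℝ) ^ (2 * m + 1) / 2 * exp (-(2 * L)) := by ring
    _ ≤ T * (1 / 2) ^ (2 * m + 1).choose 2 * m.factorial ^ 2 * exp (-(2 * L)) := by gcongr
    _ = T * weight m L * m.factorial ^ 2 := by unfold weight; ring

lemma params_two_pow {j : ℕ} (hj : 10 ≤ j) : Params (2 ^ 2 ^ j) (2 ^ j) (2 ^ j - j) := by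
  have h := hundred_mul_le_two_pow hj
  refine ⟨by omega, by omega, ?_, ?_⟩
  · calc 128 * (2 ^ j) ^ 4 = 2 ^ (7 + j * 4) := by rw [pow_add, pow_mul]; norm_num
      _ ≤ 2 ^ ((2 ^ j - j) / 4) := Nat.pow_le_pow_right (by norm_num) (by omega)
  · rw [← pow_add]; congr 1; omega

lemma sq_le_two_pow {j : ℕ} (hj : 4 ≤ j) : j ^ 2 ≤ 2 ^ j := by
  induction j, hj using Nat.le_induction with
  | base => norm_num
  | succ j hj ih => rw [pow_succ 2]; nlinarith

/-- Along `n = 2 ^ 2 ^ j` the probability of `PropertyP` stays bounded away from zero. -/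
lemma exists_pos_le_unifProb :
    ∃ c > 0, ∀ j : ℕ, 10 ≤ j → c ≤ unifProb (2 ^ 2 ^ j) PropertyP := by
  refine ⟨exp (-4) / 2 * exp (-2) / (exp (-4) / 2 * exp 3 + 3 * exp 1), by positivity,
    fun j hj => ?_⟩
  have h := params_two_pow hj
  have hjle : j ≤ 2 ^ j := Nat.lt_two_pow_self.le
  rw [div_le_iff₀ (by positivity), mul_comm (unifProb _ _)]
  exact h.le_unifProb (by positivity) (choose_mul_weight_ge h
    (by rw [Nat.sub_sub_self hjle]; exact sq_le_two_pow (by omega)))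

end Bowtie

/-- The probability that the uniform random graph `G(n,1/2)` has
property `P` does not converge as `n → ∞`. -/
theorem le_bars_conjecture_false :
    ¬ ∃ L : ℝ, Tendsto (fun n : ℕ => unifProb n PropertyP) atTop (nhds L) := by
  rintro ⟨L, hL⟩
  obtain ⟨c, hc, hle⟩ := Bowtie.exists_pos_le_unifProb
  have hpow := Bowtie.tendsto_two_pow
  have h1 : Tendsto (fun j : ℕ => 3 * 2 ^ (2 ^ j - 1)) atTop atTop :=
    (hpow.comp ((tendsto_sub_atTop_nat 1).comp hpow)).const_mul_atTop' (by norm_num)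
  have h2 := tendsto_nhds_unique (hL.comp h1) Bowtie.tendsto_unifProb_three_mul
  have h3 : c ≤ L := ge_of_tendsto (hL.comp (hpow.comp hpow))
    (eventually_atTop.2 ⟨10, fun j hj => hle j hj⟩)
  linarith
end

section
/- Along the subsequence n_k = ⌊2^{k+1/2} k⌋, the probability that the uniform random graph has property P tends to 0: lim_{k→∞} P(G(n_k,1/2) has property P) = 0. -/
open Filter Real

/-- The number of simple graphs on a finite vertex type is at most `2 ^ (card V choose 2)`. -/
lemma card_simpleGraph_le (V : Type*) [Fintype V] :
    Nat.card (SimpleGraph V) ≤ 2 ^ (Fintype.card V).choose 2 := by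
  classical
  let f : SimpleGraph V → Set {e : Sym2 V // ¬ e.IsDiag} := fun G => {e | e.1 ∈ G.edgeSet}
  have hf : Function.Injective f := by
    intro G H h
    ext u v
    by_cases huv : u = v
    · simp [huv]
    · have := Set.ext_iff.1 h ⟨s(u, v), by simpa using huv⟩
      simpa [f] using this
  refine (Nat.card_le_card_of_injective f hf).trans ?_
  rw [Nat.card_eq_fintype_card, Fintype.card_set, Sym2.card_subtype_not_diag]

/-- The number of graphs in which `(X₁, X₂, x)` is a configuration, bounded by the number of
choices of the graph outside `X₁ ∪ X₂` and of the nonempty neighborhoods in `X₁` and `X₂` of the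
remaining vertices. -/
lemma card_isConfig_le {n N : ℕ} {X₁ X₂ : Finset (Fin n)} {x : Fin n}
    (hd : Disjoint X₁ X₂) (h₁ : x ∉ X₁) (h₂ : x ∉ X₂) (hN : N + (X₁.card + X₂.card) + 1 = n) :
    Nat.card {G : SimpleGraph (Fin n) // IsConfig G X₁ X₂ x} ≤
      2 ^ (N + 1).choose 2 * ((2 ^ X₁.card - 1) * (2 ^ X₂.card - 1)) ^ N := by
  classical
  let W := {v : Fin n // v ∈ (X₁ ∪ X₂)ᶜ}
  let Y := {v : Fin n // v ∈ (X₁ ∪ X₂)ᶜ.erase x}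
  let f : {G : SimpleGraph (Fin n) // IsConfig G X₁ X₂ x} →
      SimpleGraph W × (Y → {A // A ∈ X₁.powerset.erase ∅} × {A // A ∈ X₂.powerset.erase ∅}) :=
    fun G => (G.1.comap Subtype.val, fun y =>
      (⟨X₁.filter (G.1.Adj y.1), by
        obtain ⟨-, -, -, -, -, -, -, -, -, -, hdom⟩ := G.2
        have hy := y.2
        simp only [Finset.mem_erase, Finset.mem_compl, Finset.mem_union, not_or] at hy
        obtain ⟨u, hu, huy⟩ := (hdom y.1 hy.2.1 hy.2.2).1
        simp only [Finset.mem_erase, Finset.mem_powerset, Finset.filter_subset, and_true]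
        exact Finset.ne_empty_of_mem (Finset.mem_filter.2 ⟨hu, huy⟩)⟩,
       ⟨X₂.filter (G.1.Adj y.1), by
        obtain ⟨-, -, -, -, -, -, -, -, -, -, hdom⟩ := G.2
        have hy := y.2
        simp only [Finset.mem_erase, Finset.mem_compl, Finset.mem_union, not_or] at hy
        obtain ⟨u, hu, huy⟩ := (hdom y.1 hy.2.1 hy.2.2).2
        simp only [Finset.mem_erase, Finset.mem_powerset, Finset.filter_subset, and_true]
        exact Finset.ne_empty_of_mem (Finset.mem_filter.2 ⟨hu, huy⟩)⟩))
  have hf : Function.Injective f := by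
    rintro ⟨G, hG⟩ ⟨H, hH⟩ h
    have hW := congrArg Prod.fst h
    have hY := congrArg Prod.snd h
    obtain ⟨-, -, -, -, -, hG₁, hG₂, hG₁₂, hGx₁, hGx₂, -⟩ := id hG
    obtain ⟨-, -, -, -, -, hH₁, hH₂, hH₁₂, hHx₁, hHx₂, -⟩ := id hH
    have hout : ∀ u v, u ∉ X₁ → u ∉ X₂ → v ∉ X₁ → v ∉ X₂ → (G.Adj u v ↔ H.Adj u v) := by
      intro u v hu₁ hu₂ hv₁ hv₂
      have := congrArg (fun K : SimpleGraph W =>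
        K.Adj ⟨u, by simp [hu₁, hu₂]⟩ ⟨v, by simp [hv₁, hv₂]⟩) hW
      simpa [f] using this
    have hout₁ : ∀ u v, u ∉ X₁ → u ∉ X₂ → v ∈ X₁ → (G.Adj u v ↔ H.Adj u v) := by
      intro u v hu₁ hu₂ hv
      by_cases hux : u = x
      · subst hux; exact iff_of_true (hGx₁ v hv) (hHx₁ v hv)
      have := congrArg (fun A => v ∈ A.1.1) (congrFun hY ⟨u, by simp [hu₁, hu₂, hux]⟩)
      simpa [f, hv] using this
    have hout₂ : ∀ u v, u ∉ X₁ → u ∉ X₂ → v ∈ X₂ → (G.Adj u v ↔ H.Adj u v) := by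
      intro u v hu₁ hu₂ hv
      by_cases hux : u = x
      · subst hux; exact iff_of_true (hGx₂ v hv) (hHx₂ v hv)
      have := congrArg (fun A => v ∈ A.2.1) (congrFun hY ⟨u, by simp [hu₁, hu₂, hux]⟩)
      simpa [f, hv] using this
    refine Subtype.ext (SimpleGraph.ext (funext₂ fun u v => propext ?_))
    change G.Adj u v ↔ H.Adj u v
    by_cases huv : u = v
    · simp [huv]
    by_cases hu₁ : u ∈ X₁
    · by_cases hv₁ : v ∈ X₁
      · exact iff_of_true (hG₁ u hu₁ v hv₁ huv) (hH₁ u hu₁ v hv₁ huv)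
      by_cases hv₂ : v ∈ X₂
      · exact iff_of_false (hG₁₂ u hu₁ v hv₂) (hH₁₂ u hu₁ v hv₂)
      rw [G.adj_comm, H.adj_comm]
      exact hout₁ v u hv₁ hv₂ hu₁
    by_cases hu₂ : u ∈ X₂
    · by_cases hv₁ : v ∈ X₁
      · rw [G.adj_comm, H.adj_comm]
        exact iff_of_false (hG₁₂ v hv₁ u hu₂) (hH₁₂ v hv₁ u hu₂)
      by_cases hv₂ : v ∈ X₂
      · exact iff_of_true (hG₂ u hu₂ v hv₂ huv) (hH₂ u hu₂ v hv₂ huv)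
      rw [G.adj_comm, H.adj_comm]
      exact hout₂ v u hv₁ hv₂ hu₂
    by_cases hv₁ : v ∈ X₁
    · exact hout₁ u v hu₁ hu₂ hv₁
    by_cases hv₂ : v ∈ X₂
    · exact hout₂ u v hu₁ hu₂ hv₂
    exact hout u v hu₁ hu₂ hv₁ hv₂
  have hWc : (X₁ ∪ X₂)ᶜ.card = N + 1 := by
    rw [Finset.card_compl, Finset.card_union_of_disjoint hd, Fintype.card_fin]
    omega
  have hYc : ((X₁ ∪ X₂)ᶜ.erase x).card = N := by
    rw [Finset.card_erase_of_mem (by simp [h₁, h₂]), hWc, Nat.add_sub_cancel]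
  have hA : ∀ X : Finset (Fin n), (X.powerset.erase ∅).card = 2 ^ X.card - 1 := fun X => by
    rw [Finset.card_erase_of_mem (Finset.empty_mem_powerset X), Finset.card_powerset]
  have hWn := card_simpleGraph_le W
  rw [Fintype.card_coe, hWc] at hWn
  refine (Nat.card_le_card_of_injective f hf).trans ?_
  rw [Nat.card_prod, Nat.card_fun, Nat.card_prod]
  simp only [Nat.card_eq_fintype_card (α := Y), Nat.card_eq_fintype_card
    (α := {A // A ∈ X₁.powerset.erase ∅}), Nat.card_eq_fintype_card
    (α := {A // A ∈ X₂.powerset.erase ∅}), Y, Fintype.card_coe, hYc, hA]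
  exact Nat.mul_le_mul_right _ hWn

/-- The probability that `(X₁, X₂, x)` is a configuration. -/
lemma unifProb_isConfig_le {n N : ℕ} {X₁ X₂ : Finset (Fin n)} {x : Fin n}
    (hd : Disjoint X₁ X₂) (h₁ : x ∉ X₁) (h₂ : x ∉ X₂) (hN : N + (X₁.card + X₂.card) + 1 = n) :
    unifProb n (fun G => IsConfig G X₁ X₂ x) ≤
      ((1 - (1 / 2 : ℝ) ^ X₁.card) * (1 - (1 / 2 : ℝ) ^ X₂.card)) ^ N /
        2 ^ (X₁.card + X₂.card + 1).choose 2 := by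
  have h : (Nat.card {G : SimpleGraph (Fin n) // IsConfig G X₁ X₂ x} : ℝ) ≤
      2 ^ (N + 1).choose 2 * ((2 ^ X₁.card - 1) * (2 ^ X₂.card - 1)) ^ N := by
    have h := card_isConfig_le hd h₁ h₂ hN
    rw [← Nat.cast_le (α := ℝ)] at h
    push_cast [Nat.one_le_two_pow] at h
    exact h
  rw [unifProb, div_le_div_iff₀ (by positivity) (by positivity)]
  generalize X₁.card = a at *
  generalize X₂.card = b at *
  have hc : n.choose 2 = (N + 1).choose 2 + (a + b + 1).choose 2 + (a + b) * N := by
    subst hN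
    rw [← Nat.cast_inj (R := ℚ)]
    push_cast [Nat.cast_choose_two]
    ring
  have e : ∀ c : ℕ, (2 : ℝ) ^ c - 1 = 2 ^ c * (1 - (1 / 2) ^ c) := fun c => by
    rw [mul_sub, ← mul_pow]; norm_num
  calc _ ≤ _ := mul_le_mul_of_nonneg_right h (by positivity)
    _ = _ := by
      rw [hc, e, e]
      simp only [pow_add, pow_mul, mul_pow]
      ring

/-- The normalized exponent `i + 2 ^ (1 - i)`, `i = a - k`, is at least `2` at integers. -/
lemma two_le_sub_add_two_pow_div (a k : ℕ) : (2 : ℝ) ≤ a - k + 2 * (2 ^ k / 2 ^ a) := by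
  rcases le_or_gt a k with h | h
  · obtain ⟨j, rfl⟩ := Nat.exists_eq_add_of_le h
    have : (j : ℝ) + 1 ≤ 2 ^ j := by exact_mod_cast Nat.lt_two_pow_self
    rw [pow_add, mul_div_cancel_left₀ _ (by positivity)]
    push_cast
    linarith [(Nat.cast_nonneg j : (0 : ℝ) ≤ j)]
  · obtain ⟨j, rfl⟩ := Nat.exists_eq_add_of_lt h
    rcases j with _ | j
    · have : (2 : ℝ) * (2 ^ k / 2 ^ (k + 0 + 1)) = 1 := by
        rw [add_zero, pow_succ]
        field_simp
      push_cast
      linarith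
    · have : (0 : ℝ) ≤ 2 ^ k / 2 ^ (k + (j + 1) + 1) := by positivity
      push_cast
      linarith [(Nat.cast_nonneg j : (0 : ℝ) ≤ j)]

lemma one_sub_half_pow_pow_le {k N : ℕ} (hN : 2 * log 2 * (k * 2 ^ k) ≤ N) (a : ℕ) :
    (1 - (1 / 2 : ℝ) ^ a) ^ N ≤ 2 ^ (-(2 * k * (2 ^ k / 2 ^ a)) : ℝ) := by
  have h0 : (1 / 2 : ℝ) ^ a ≤ 1 := pow_le_one₀ (by norm_num) (by norm_num)
  calc (1 - (1 / 2 : ℝ) ^ a) ^ N ≤ exp (-(1 / 2 : ℝ) ^ a) ^ N :=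
        pow_le_pow_left₀ (by linarith) (one_sub_le_exp_neg _) _
    _ = exp (-(N * (1 / 2 : ℝ) ^ a)) := by rw [← exp_nat_mul]; ring_nf
    _ ≤ exp (-(2 * log 2 * (k * 2 ^ k) * (1 / 2 : ℝ) ^ a)) := by gcongr
    _ = _ := by
      rw [rpow_def_of_pos two_pos, one_div, inv_pow]
      ring_nf

/-- The first moment estimate for clique sizes `a` and `b`. -/
lemma config_weight_le {k a b N n : ℕ} (hk : 9 ≤ k) (hn : (n : ℝ) ≤ 2 ^ ((k : ℝ) + 1 / 2) * k)
    (hn' : (2 : ℝ) ^ ((k : ℝ) + 1 / 2) * k < n + 1) (hN : N + (a + b) + 1 = n) :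
    ((1 - (1 / 2 : ℝ) ^ a) * (1 - (1 / 2 : ℝ) ^ b)) ^ N / 2 ^ (a + b + 1).choose 2 ≤
      (1 / 16) ^ k * ((k / n : ℝ) ^ a * (k / n : ℝ) ^ b) := by
  have hk0 : (9 : ℝ) ≤ k := by exact_mod_cast hk
  have hn0 : (0 : ℝ) < n := by exact_mod_cast (by omega : 0 < n)
  have hle : ∀ c : ℕ, (1 / 2 : ℝ) ^ c ≤ 1 := fun c => pow_le_one₀ (by norm_num) (by norm_num)
  have hD0 : ∀ c : ℕ, 0 ≤ (1 - (1 / 2 : ℝ) ^ c) := fun c => by linarith [hle c]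
  have hD1 : ∀ c : ℕ, (1 - (1 / 2 : ℝ) ^ c) ≤ 1 := fun c => by
    linarith [pow_pos (by norm_num : (0 : ℝ) < 1 / 2) c]
  have hratio : (2 : ℝ) ^ (-((k : ℝ) + 1 / 2)) ≤ k / n := by
    rw [rpow_neg two_pos.le, inv_eq_one_div, div_le_div_iff₀ (by positivity) hn0]
    linarith
  have hchoose : (((a + b + 1).choose 2 : ℕ) : ℝ) = (a + b) * (a + b + 1) / 2 := by
    rw [Nat.cast_choose_two]; push_cast; ring
  have hpow : (2 : ℝ) ^ (-((k : ℝ) + 1 / 2) * (a + b)) ≤ (k / n : ℝ) ^ a * (k / n : ℝ) ^ b := by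
    rw [← pow_add, rpow_mul two_pos.le, ← Nat.cast_add, rpow_natCast]
    gcongr
  have h16 : (1 / 16 : ℝ) ^ k = 2 ^ (-(4 * k) : ℝ) := by
    rw [neg_mul_eq_neg_mul, rpow_mul two_pos.le, rpow_natCast]
    norm_num [rpow_neg]
  suffices h : ((1 - (1 / 2 : ℝ) ^ a) * (1 - (1 / 2 : ℝ) ^ b)) ^ N ≤
      2 ^ (-(4 * k) + -((k : ℝ) + 1 / 2) * (a + b) + (a + b) * (a + b + 1) / 2) by
    rw [div_le_iff₀ (by positivity), h16]
    refine h.trans ?_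
    rw [rpow_add two_pos, rpow_add two_pos, ← hchoose, rpow_natCast]
    gcongr
  rcases le_or_gt (a + b) (2 * k + 3) with hs | hs
  · have hs' : (a : ℝ) + b ≤ 2 * k + 3 := by exact_mod_cast hs
    have hNr : (N : ℝ) + (a + b) + 1 = n := by exact_mod_cast hN
    have hNk : 2 * log 2 * (k * 2 ^ k) ≤ N := by
      have htwo : (512 : ℝ) ≤ 2 ^ k := by
        calc (512 : ℝ) = 2 ^ 9 := by norm_num
          _ ≤ 2 ^ k := pow_le_pow_right₀ (by norm_num) hk
      have hsqrt : (1.414 : ℝ) ≤ √2 := Real.le_sqrt_of_sq_le (by norm_num)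
      rw [rpow_add two_pos, rpow_natCast, ← sqrt_eq_rpow] at hn'
      have hpos : 0 ≤ (k : ℝ) * 2 ^ k := by positivity
      have hkk : (k : ℝ) * 512 ≤ k * 2 ^ k := by gcongr
      have := mul_le_mul_of_nonneg_right hsqrt hpos
      have := mul_le_mul_of_nonneg_right log_two_lt_d9.le hpos
      nlinarith
    rw [mul_pow]
    calc _ ≤ (2 : ℝ) ^ (-(2 * k * (2 ^ k / 2 ^ a)) : ℝ) * 2 ^ (-(2 * k * (2 ^ k / 2 ^ b)) : ℝ) :=
          mul_le_mul (one_sub_half_pow_pow_le hNk a) (one_sub_half_pow_pow_le hNk b)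
            (pow_nonneg (hD0 b) N) (by positivity)
      _ = 2 ^ (-(2 * k * (2 ^ k / 2 ^ a)) + -(2 * k * (2 ^ k / 2 ^ b)) : ℝ) :=
          (rpow_add two_pos _ _).symm
      _ ≤ _ := by
        refine rpow_le_rpow_of_exponent_le one_le_two ?_
        have ha := mul_le_mul_of_nonneg_left (two_le_sub_add_two_pow_div a k)
          (Nat.cast_nonneg k : (0 : ℝ) ≤ k)
        have hb := mul_le_mul_of_nonneg_left (two_le_sub_add_two_pow_div b k)
          (Nat.cast_nonneg k : (0 : ℝ) ≤ k)
        nlinarith [sq_nonneg ((a : ℝ) + b - 2 * k)]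
  · have hs' : 2 * (k : ℝ) + 4 ≤ a + b := by exact_mod_cast hs
    calc _ ≤ (1 : ℝ) := pow_le_one₀ (mul_nonneg (hD0 a) (hD0 b))
          (mul_le_one₀ (hD1 a) (hD0 b) (hD1 b))
      _ ≤ _ := one_le_rpow one_le_two (by nlinarith)

/-- The union bound over all possible configurations. -/
lemma unifProb_propertyP_le_sum (n : ℕ) :
    unifProb n PropertyP ≤ ∑ X₁ : Finset (Fin n), ∑ X₂ : Finset (Fin n), ∑ x : Fin n,
      unifProb n (fun G => IsConfig G X₁ X₂ x) := by
  classical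
  simp only [unifProb, ← Finset.sum_div]
  gcongr
  have h : ∀ Q : SimpleGraph (Fin n) → Prop,
      Nat.card {G : SimpleGraph (Fin n) // Q G} = (Finset.univ.filter Q).card := fun Q => by
    rw [Nat.card_eq_fintype_card, Fintype.card_subtype]
  simp only [h]
  norm_cast
  have : Finset.univ.filter (PropertyP (n := n)) = Finset.univ.biUnion fun X₁ =>
      Finset.univ.biUnion fun X₂ => Finset.univ.biUnion fun x =>
        Finset.univ.filter (fun G => IsConfig G X₁ X₂ x) := by
    ext G; simp [PropertyP]
  rw [this]
  refine Finset.card_biUnion_le.trans (Finset.sum_le_sum fun X₁ _ => ?_)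
  refine Finset.card_biUnion_le.trans (Finset.sum_le_sum fun X₂ _ => ?_)
  exact Finset.card_biUnion_le

lemma unifProb_isConfig_le_of_floor {k n : ℕ} (hk : 9 ≤ k)
    (hn : n = ⌊(2 : ℝ) ^ ((k : ℝ) + 1 / 2) * k⌋₊) (X₁ X₂ : Finset (Fin n)) (x : Fin n) :
    unifProb n (fun G => IsConfig G X₁ X₂ x) ≤
      (1 / 16) ^ k * ((k / n : ℝ) ^ X₁.card * (k / n : ℝ) ^ X₂.card) := by
  classical
  by_cases h : Disjoint X₁ X₂ ∧ x ∉ X₁ ∧ x ∉ X₂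
  · obtain ⟨hd, h₁, h₂⟩ := h
    have hlt : (X₁ ∪ X₂).card < n := by
      have := Finset.card_lt_univ_of_notMem (s := X₁ ∪ X₂) (x := x) (by simp [h₁, h₂])
      rwa [Fintype.card_fin] at this
    rw [Finset.card_union_of_disjoint hd] at hlt
    have hN : (n - 1 - (X₁.card + X₂.card)) + (X₁.card + X₂.card) + 1 = n := by omega
    refine (unifProb_isConfig_le hd h₁ h₂ hN).trans (config_weight_le hk ?_ ?_ hN)
    · exact hn ▸ Nat.floor_le (by positivity)
    · exact hn ▸ Nat.lt_floor_add_one _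
  · have : IsEmpty {G : SimpleGraph (Fin n) // IsConfig G X₁ X₂ x} :=
      ⟨fun ⟨_, _, _, hd, h₁, h₂, _⟩ => h ⟨hd, h₁, h₂⟩⟩
    rw [unifProb, Nat.card_of_isEmpty, Nat.cast_zero, zero_div]
    positivity

lemma unifProb_propertyP_le {k : ℕ} (hk : 9 ≤ k) :
    unifProb ⌊(2 : ℝ) ^ ((k : ℝ) + 1 / 2) * k⌋₊ PropertyP ≤
      √2 * (k * (exp 1 ^ 2 / 8) ^ k) := by
  obtain ⟨n, hn⟩ : ∃ n, n = ⌊(2 : ℝ) ^ ((k : ℝ) + 1 / 2) * k⌋₊ := ⟨_, rfl⟩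
  have hle : (n : ℝ) ≤ √2 * 2 ^ k * k := by
    have : (n : ℝ) ≤ 2 ^ ((k : ℝ) + 1 / 2) * k := hn ▸ Nat.floor_le (by positivity)
    rwa [rpow_add two_pos, rpow_natCast, ← sqrt_eq_rpow, mul_comm (2 ^ k : ℝ)] at this
  have hsum : ∑ X : Finset (Fin n), (k / n : ℝ) ^ X.card ≤ exp 1 ^ k := by
    have h := Fin.sum_pow_mul_eq_add_pow (n := n) (k / n : ℝ) 1
    simp only [one_pow, mul_one] at h
    rw [h]
    calc (k / n + 1 : ℝ) ^ n ≤ exp (k / n) ^ n := by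
          gcongr
          exact add_one_le_exp _
      _ = exp (n * (k / n)) := (exp_nat_mul _ _).symm
      _ ≤ exp (k * 1) := by
        rw [mul_one, exp_le_exp]
        rcases eq_or_ne n 0 with h0 | h0
        · simp [h0]
        · exact (mul_div_cancel₀ _ (Nat.cast_ne_zero.2 h0)).le
      _ = exp 1 ^ k := exp_nat_mul _ _
  rw [← hn]
  calc unifProb n PropertyP
      ≤ ∑ X₁ : Finset (Fin n), ∑ X₂ : Finset (Fin n), ∑ _x : Fin n,
          (1 / 16 : ℝ) ^ k * ((k / n : ℝ) ^ X₁.card * (k / n : ℝ) ^ X₂.card) := by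
        refine (unifProb_propertyP_le_sum n).trans ?_
        gcongr
        exact unifProb_isConfig_le_of_floor hk hn _ _ _
    _ = n * (1 / 16 : ℝ) ^ k * ((∑ X : Finset (Fin n), (k / n : ℝ) ^ X.card) *
          ∑ X : Finset (Fin n), (k / n : ℝ) ^ X.card) := by
        rw [Finset.sum_mul_sum]
        simp only [Finset.sum_const, Finset.card_univ, Fintype.card_fin, nsmul_eq_mul,
          Finset.mul_sum, mul_assoc]
    _ ≤ (√2 * 2 ^ k * k) * (1 / 16 : ℝ) ^ k * (exp 1 ^ k * exp 1 ^ k) := by gcongr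
    _ = √2 * (k * (exp 1 ^ 2 / 8) ^ k) := by
        rw [show exp 1 ^ 2 / 8 = 2 * (1 / 16) * (exp 1 * exp 1) by ring]
        simp only [mul_pow]
        ring

/-- Along the subsequence `n_k = ⌊2^(k+1/2) k⌋`, the probability that
the uniform random graph has property `P` tends to `0`. -/
theorem prob_propertyP_tendsto_zero :
    Tendsto (fun k : ℕ => unifProb ⌊(2:ℝ) ^ ((k:ℝ) + 1/2) * k⌋₊ PropertyP)
      atTop (nhds 0) := by
  have hlt : exp 1 ^ 2 / 8 < 1 := by nlinarith [exp_one_lt_d9, exp_pos 1]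
  have hlim := (tendsto_self_mul_const_pow_of_lt_one (by positivity) hlt).const_mul √2
  rw [mul_zero] at hlim
  refine squeeze_zero' (Eventually.of_forall fun k => ?_) ?_ hlim
  · unfold unifProb
    positivity
  · filter_upwards [eventually_ge_atTop 9] with k hk
    exact unifProb_propertyP_le hk
end
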